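/- Let 0 < r ≤ 1, 0 < p, q < ∞ with q < p ≤ r (so in particular q < p ≤ 1), and let u, v, w be weights on (a,b) with 0 < W(x) := ∫_x^b w < ∞ for all x ∈ (a,b). Then the inequality (∫_a^b (∫_a^t f(s)^r v(s) ds)^{q/r} u(t) dt)^{1/q} ≤ C (∫_a^b (∫_a^t f(s) ds)^p w(t) dt)^{1/p} holds for all nonnegative measurable f on (a,b) if and only if C_4 < ∞ and C_5 < ∞, where C_4 = ( ∫_a^b (∫_x^b u)^{q/(p−q)} u(x) ess sup_{t ∈ (a,x)} W(t)^{−q/(p−q)} V_r(t,x)^{pq/(p−q)} dx )^{(p−q)/(pq)} and C_5 = ( ∫_a^b w(x) ess sup_{y ∈ (a,x)} W(y)^{−p/(p−q)} ( ∫_y^x (∫_t^x u)^{q/(1−q)} u(t) V_r(y,t)^{q/(1−q)} dt )^{p(1−q)/(p−q)} dx )^{(p−q)/(pq)}; moreover the best constant C satisfies C ≈ C_4 + C_5. -/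

import Mathlib

open MeasureTheory Set ENNReal

/-- The interval `(x, y)` in `ℝ` with extended-real endpoints. -/
def erIoo (x y : EReal) : Set ℝ := {t : ℝ | x < (t : EReal) ∧ (t : EReal) < y}

/-- `W(x) = ∫_x^b w`. -/
noncomputable def Wf (w : ℝ → ℝ≥0∞) (b : EReal) (x : ℝ) : ℝ≥0∞ :=
  ∫⁻ t in erIoo (x : EReal) b, w t

/-- The quantity `V_r(x,y)`: `(∫_x^y v^{1/(1-r)})^{(1-r)/r}` when `r < 1`, and
`ess sup_{(x,y)} v` when `r = 1`. -/
noncomputable def Vr (r : ℝ) (v : ℝ → ℝ≥0∞) (x : ℝ) (y : EReal) : ℝ≥0∞ :=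
  if r = 1 then essSup v (volume.restrict (erIoo (x : EReal) y))
  else (∫⁻ s in erIoo (x : EReal) y, v s ^ (1 / (1 - r))) ^ ((1 - r) / r)

/-- The left-hand side of the main inequality:
`(∫_a^b (∫_a^t f^r v)^{q/r} u(t) dt)^{1/q}`. -/
noncomputable def mainLHS (q r : ℝ) (a : ℝ) (b : EReal) (u v f : ℝ → ℝ≥0∞) : ℝ≥0∞ :=
  (∫⁻ t in erIoo (a : EReal) b, (∫⁻ s in Set.Ioo a t, f s ^ r * v s) ^ (q / r) * u t) ^ (1 / q)

/-- The right-hand side (without the constant) of the main inequality: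
`(∫_a^b (∫_a^t f)^p w(t) dt)^{1/p}`. -/
noncomputable def mainRHS (p : ℝ) (a : ℝ) (b : EReal) (w f : ℝ → ℝ≥0∞) : ℝ≥0∞ :=
  (∫⁻ t in erIoo (a : EReal) b, (∫⁻ s in Set.Ioo a t, f s) ^ p * w t) ^ (1 / p)

/-- The constant `C₄`. -/
noncomputable def C4const (p q r : ℝ) (a : ℝ) (b : EReal) (u v w : ℝ → ℝ≥0∞) : ℝ≥0∞ :=
  (∫⁻ x in erIoo (a : EReal) b,
      (∫⁻ t in erIoo ((x : ℝ) : EReal) b, u t) ^ (q / (p - q)) * u x *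
        essSup (fun t => Wf w b t ^ (-(q / (p - q))) *
            Vr r v t ((x : ℝ) : EReal) ^ (p * q / (p - q)))
          (volume.restrict (Set.Ioo a x))) ^ ((p - q) / (p * q))

/-- The constant `C₅`. -/
noncomputable def C5const (p q r : ℝ) (a : ℝ) (b : EReal) (u v w : ℝ → ℝ≥0∞) : ℝ≥0∞ :=
  (∫⁻ x in erIoo (a : EReal) b,
      w x * essSup (fun y =>
          Wf w b y ^ (-(p / (p - q))) *
            (∫⁻ t in Set.Ioo y x,
                (∫⁻ s in Set.Ioo t x, u s) ^ (q / (1 - q)) * u t *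
                  Vr r v y ((t : ℝ) : EReal) ^ (q / (1 - q))) ^ (p * (1 - q) / (p - q)))
        (volume.restrict (Set.Ioo a x))) ^ ((p - q) / (p * q))

/-- Real powers of two in `ℝ≥0∞`. -/
noncomputable def tp (x : ℝ) : ℝ≥0∞ := (2 : ℝ≥0∞) ^ x

lemma tp_pos (x : ℝ) : 0 < tp x := ENNReal.rpow_pos (by norm_num) (by norm_num)
lemma tp_ne_zero (x : ℝ) : tp x ≠ 0 := (tp_pos x).ne'
lemma tp_ne_top (x : ℝ) : tp x ≠ ∞ :=
  ENNReal.rpow_ne_top_of_ne_zero (by norm_num) (by norm_num)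
lemma tp_lt_top (x : ℝ) : tp x < ∞ := (tp_ne_top x).lt_top
lemma tp_add (x y : ℝ) : tp (x + y) = tp x * tp y :=
  ENNReal.rpow_add _ _ (by norm_num) (by norm_num)
lemma tp_zero : tp 0 = 1 := by simp [tp]
lemma tp_one : tp 1 = 2 := by simp [tp]
lemma tp_rpow (x y : ℝ) : tp x ^ y = tp (x * y) := by
  simp [tp, ENNReal.rpow_mul]
lemma tp_mono {x y : ℝ} (h : x ≤ y) : tp x ≤ tp y :=
  ENNReal.rpow_le_rpow_of_exponent_le (by norm_num) h
lemma tp_lt {x y : ℝ} (h : x < y) : tp x < tp y :=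
  ENNReal.rpow_lt_rpow_of_exponent_lt (by norm_num) (by norm_num) h
lemma tp_neg (x : ℝ) : tp (-x) = (tp x)⁻¹ := ENNReal.rpow_neg _ _
lemma tp_mul_neg (x : ℝ) : tp x * tp (-x) = 1 := by
  rw [← tp_add]; simp [tp_zero]

lemma le_rpow_one_div {x y : ℝ≥0∞} {z : ℝ} (hz : 0 < z) : x ≤ y ^ (1 / z) ↔ x ^ z ≤ y := by
  rw [one_div, ENNReal.le_rpow_inv_iff hz]

lemma tp_geo (d : ℝ) (hd : 0 < d) : ∑' n : ℕ, tp (-(d * n)) < ∞ := by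
  have h : ∀ n : ℕ, tp (-(d * n)) = (tp (-d)) ^ n := by
    intro n
    rw [← ENNReal.rpow_natCast, tp_rpow]; congr 1; ring
  simp_rw [h]
  rw [ENNReal.tsum_geometric]
  have : tp (-d) < 1 := by
    rw [← tp_zero]; exact tp_lt (by linarith)
  simp only [ENNReal.inv_lt_top]
  exact tsub_pos_of_lt this

lemma tp_geo_one : ∑' n : ℕ, tp (-(n : ℝ)) = 2 := by
  have h : ∀ n : ℕ, tp (-(n : ℝ)) = (2⁻¹ : ℝ≥0∞) ^ n := by
    intro n
    rw [tp_neg, tp, ENNReal.rpow_natCast, ENNReal.inv_pow]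
  simp_rw [h]
  rw [ENNReal.tsum_geometric]
  simp

/-- Discrete geometric-weight Hardy inequality. -/
lemma geo_sum (γ : ℝ) (hγ : 0 < γ) : ∃ C : ℝ≥0∞, C < ∞ ∧ ∀ m : ℤ → ℝ≥0∞,
    ∑' k : ℤ, tp (-(k : ℝ)) * (∑' n : ℕ, m (k - n)) ^ γ ≤
      C * ∑' k : ℤ, tp (-(k : ℝ)) * m k ^ γ := by
  set d : ℝ := 1 / (2 * γ) with hd
  have hd0 : 0 < d := by positivity
  set K := ∑' n : ℕ, tp (-(d * n)) with hK
  have hKt : K < ∞ := tp_geo d hd0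
  set K2 := ∑' n : ℕ, tp (-((1 / 2 : ℝ) * n)) with hK2
  have hK2t : K2 < ∞ := tp_geo _ (by norm_num)
  refine ⟨K ^ γ * K2, ENNReal.mul_lt_top (ENNReal.rpow_lt_top_of_nonneg hγ.le hKt.ne) hK2t, ?_⟩
  intro m
  have key : ∀ k : ℤ, (∑' n : ℕ, m (k - n)) ^ γ ≤
      K ^ γ * ∑' n : ℕ, tp ((1 / 2 : ℝ) * n) * m (k - n) ^ γ := by
    intro k
    set T := ∑' n : ℕ, tp ((1 / 2 : ℝ) * n) * m (k - n) ^ γ with hT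
    have h1 : ∀ n : ℕ, tp (d * n) * m (k - n) ≤ T ^ (1 / γ) := by
      intro n
      rw [le_rpow_one_div hγ, ENNReal.mul_rpow_of_nonneg _ _ hγ.le, tp_rpow]
      have : d * n * γ = (1 / 2 : ℝ) * n := by rw [hd]; field_simp
      rw [this]
      exact ENNReal.le_tsum (f := fun n : ℕ => tp ((1 / 2 : ℝ) * n) * m (k - n) ^ γ) n
    have h2 : ∑' n : ℕ, m (k - n) ≤ K * T ^ (1 / γ) := by
      rw [hK, ← ENNReal.tsum_mul_right]
      refine ENNReal.tsum_le_tsum fun n => ?_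
      calc m (k - n) = tp (-(d * n)) * (tp (d * n) * m (k - n)) := by
            rw [← mul_assoc, mul_comm (tp _), tp_mul_neg, one_mul]
        _ ≤ _ := by gcongr; exact h1 n
    calc _ ≤ (K * T ^ (1 / γ)) ^ γ := ENNReal.rpow_le_rpow h2 hγ.le
      _ = K ^ γ * T := by
        rw [ENNReal.mul_rpow_of_nonneg _ _ hγ.le, ← ENNReal.rpow_mul,
          one_div_mul_cancel hγ.ne', ENNReal.rpow_one]
  calc _ ≤ ∑' k : ℤ, tp (-(k : ℝ)) * (K ^ γ * ∑' n : ℕ, tp ((1 / 2 : ℝ) * n) * m (k - n) ^ γ) :=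
        ENNReal.tsum_le_tsum fun k => by gcongr; exact key k
    _ = K ^ γ * ∑' k : ℤ, ∑' n : ℕ,
          tp (-((1 / 2 : ℝ) * n)) * (tp (-((k - n : ℤ) : ℝ)) * m (k - n) ^ γ) := by
        rw [← ENNReal.tsum_mul_left]
        refine tsum_congr fun k => ?_
        rw [mul_left_comm, ← ENNReal.tsum_mul_left]
        congr 1
        refine tsum_congr fun n => ?_
        rw [← mul_assoc, ← mul_assoc, ← tp_add, ← tp_add]
        congr 2; push_cast; ring
    _ = K ^ γ * ∑' n : ℕ, tp (-((1 / 2 : ℝ) * n)) *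
          ∑' k : ℤ, (tp (-((k - n : ℤ) : ℝ)) * m (k - n) ^ γ) := by
        rw [ENNReal.tsum_comm]
        congr 1
        refine tsum_congr fun n => ?_
        rw [ENNReal.tsum_mul_left]
    _ = K ^ γ * ∑' n : ℕ, tp (-((1 / 2 : ℝ) * n)) * ∑' k : ℤ, (tp (-(k : ℝ)) * m k ^ γ) := by
        congr 1
        refine tsum_congr fun n => ?_
        congr 1
        exact (Equiv.subRight (n : ℤ)).tsum_eq (fun k : ℤ => tp (-(k : ℝ)) * m k ^ γ)
    _ = _ := by rw [ENNReal.tsum_mul_right, mul_assoc]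

lemma geo_finset (K : Finset ℤ) (hK : K.Nonempty) :
    ∑ i ∈ K, tp (i : ℝ) ≤ 2 * tp ((K.max' hK : ℤ) : ℝ) := by
  set M := K.max' hK
  have : ∑ i ∈ K, tp (i : ℝ) ≤ ∑' n : ℕ, tp ((M : ℝ) - n) := by
    have hinj : Set.InjOn (fun i : ℤ => (M - i).toNat) K := by
      intro i hi j hj h
      have h1 := K.le_max' i hi
      have h2 := K.le_max' j hj
      simp only at h
      omega
    calc _ = ∑ n ∈ K.image (fun i : ℤ => (M - i).toNat), tp ((M : ℝ) - n) := by
          rw [Finset.sum_image hinj]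
          refine Finset.sum_congr rfl fun i hi => ?_
          have h1 := K.le_max' i hi
          congr 1
          have : ((M - i).toNat : ℤ) = M - i := Int.toNat_of_nonneg (by omega)
          have h3 : ((M - i).toNat : ℝ) = M - i := by exact_mod_cast this
          rw [h3]; ring
      _ ≤ _ := ENNReal.sum_le_tsum _
  refine this.trans ?_
  simp_rw [sub_eq_add_neg, tp_add]
  rw [ENNReal.tsum_mul_left, tp_geo_one, mul_comm]

/-- Hölder for sums over `ℤ`, in the form used below. -/
lemma holder_tsum (s : ℝ) (hs : 0 < s) (hs1 : s < 1) (x y : ℤ → ℝ≥0∞) :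
    ∑' k, x k ^ s * y k ^ (1 - s) ≤ (∑' k, x k) ^ s * (∑' k, y k) ^ (1 - s) := by
  have hc : (1 / s).HolderConjugate (1 / (1 - s)) := by
    rw [Real.holderConjugate_iff]
    constructor
    · rw [lt_div_iff₀ hs]; linarith
    · simp
  have := ENNReal.lintegral_mul_le_Lp_mul_Lq (Measure.count : Measure ℤ) hc
    (f := fun k => x k ^ s) (g := fun k => y k ^ (1 - s))
    (measurable_of_countable _).aemeasurable (measurable_of_countable _).aemeasurable
  simp only [lintegral_count, Pi.mul_apply, ← ENNReal.rpow_mul] at this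
  have h1 : s * (1 / s) = 1 := by field_simp
  have h2 : (1 - s) * (1 / (1 - s)) = 1 := by
    have : (1 - s) ≠ 0 := by linarith
    field_simp
  simp only [h1, h2, ENNReal.rpow_one, one_div_one_div] at this
  exact this

lemma add_rpow_le (γ : ℝ) (hγ : 0 < γ) (x y : ℝ≥0∞) :
    (x + y) ^ γ ≤ tp γ * (x ^ γ + y ^ γ) := by
  have h : x + y ≤ 2 * max x y := by
    rw [two_mul]; exact add_le_add (le_max_left _ _) (le_max_right _ _)
  calc _ ≤ (2 * max x y) ^ γ := ENNReal.rpow_le_rpow h hγ.le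
    _ = tp γ * (max x y) ^ γ := by rw [ENNReal.mul_rpow_of_nonneg _ _ hγ.le, tp]
    _ ≤ _ := by
      gcongr
      rcases le_total x y with h | h
      · rw [max_eq_right h]; exact le_add_self
      · rw [max_eq_left h]; exact le_self_add

lemma finset_rpow_le (s : Finset ℤ) (γ : ℝ) (h0 : 0 < γ) (h1 : γ ≤ 1) (x : ℤ → ℝ≥0∞) :
    (∑ i ∈ s, x i) ^ γ ≤ ∑ i ∈ s, x i ^ γ := by
  classical
  induction s using Finset.induction_on with
  | empty => simp [h0]
  | insert a s ha ih =>
    rw [Finset.sum_insert ha, Finset.sum_insert ha]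
    exact (ENNReal.rpow_add_le_add_rpow _ _ h0.le h1).trans (by gcongr)

lemma tsum_rpow_le (γ : ℝ) (h0 : 0 < γ) (h1 : γ ≤ 1) (x : ℤ → ℝ≥0∞) :
    (∑' i, x i) ^ γ ≤ ∑' i, x i ^ γ := by
  rw [← ENNReal.le_rpow_inv_iff h0, ENNReal.tsum_eq_iSup_sum]
  refine iSup_le fun s => ?_
  rw [ENNReal.le_rpow_inv_iff h0]
  exact (finset_rpow_le s γ h0 h1 x).trans (ENNReal.sum_le_tsum _)

/-- Self-improving inequality. -/
lemma self_improve {E K : ℝ≥0∞} {s : ℝ} (hs : 0 < s) (hs1 : s < 1) (hE : E < ∞)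
    (h : E ≤ K * E ^ s) : E ≤ K ^ (1 / (1 - s)) := by
  have h1s : 0 < 1 - s := by linarith
  rcases eq_or_ne E 0 with h0 | h0
  · simp [h0]
  rw [le_rpow_one_div h1s]
  have hEs : E ^ s ≠ 0 := (ENNReal.rpow_pos (pos_iff_ne_zero.2 h0) hE.ne).ne'
  have hEt : E ^ s ≠ ∞ := ENNReal.rpow_ne_top_of_nonneg hs.le hE.ne
  rw [ENNReal.rpow_sub _ _ h0 hE.ne, ENNReal.rpow_one]
  exact (ENNReal.div_le_iff hEs hEt).2 h

lemma erIoo_coe (x y : ℝ) : erIoo (x : EReal) (y : EReal) = Ioo x y := by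
  ext t; simp [erIoo]

lemma measurableSet_erIoo (x y : EReal) : MeasurableSet (erIoo x y) := by
  have : OrdConnected (erIoo x y) := by
    constructor
    intro s hs t ht z hz
    exact ⟨hs.1.trans_le (by exact_mod_cast hz.1), lt_of_le_of_lt (by exact_mod_cast hz.2) ht.2⟩
  exact this.measurableSet

lemma erIoo_subset {x y x' y' : EReal} (h1 : x' ≤ x) (h2 : y ≤ y') : erIoo x y ⊆ erIoo x' y' :=
  fun _ ht => ⟨h1.trans_lt ht.1, ht.2.trans_le h2⟩

lemma Ioo_subset_erIoo {x y : ℝ} {a b : EReal} (h1 : a ≤ x) (h2 : (y : EReal) ≤ b) :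
    Ioo x y ⊆ erIoo a b := by
  rw [← erIoo_coe]; exact erIoo_subset h1 h2

lemma Ioc_subset_erIoo {x y : ℝ} {a b : EReal} (h1 : a ≤ x) (h2 : (y : EReal) < b) :
    Ioc x y ⊆ erIoo a b := fun _ ht =>
  ⟨h1.trans_lt (by exact_mod_cast ht.1), lt_of_le_of_lt (by exact_mod_cast ht.2) h2⟩

lemma lint_Ioc_Ioo (f : ℝ → ℝ≥0∞) (x y : ℝ) : ∫⁻ t in Ioc x y, f t = ∫⁻ t in Ioo x y, f t :=
  setLIntegral_congr Ioo_ae_eq_Ioc.symm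

lemma exists_mem_erIoo {x y : EReal} (h : x < y) : ∃ t : ℝ, t ∈ erIoo x y := by
  obtain ⟨q, h1, h2⟩ := EReal.lt_iff_exists_rat_btwn.1 h
  exact ⟨(q : ℝ), h1, h2⟩

lemma Wf_anti (w : ℝ → ℝ≥0∞) (b : EReal) {x y : ℝ} (h : x ≤ y) : Wf w b y ≤ Wf w b x :=
  lintegral_mono_set (erIoo_subset (by exact_mod_cast h) le_rfl)

lemma Wf_split (w : ℝ → ℝ≥0∞) (b : EReal) {x y : ℝ} (h : x ≤ y) (hy : (y : EReal) < b) :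
    Wf w b x = (∫⁻ t in Ioc x y, w t) + Wf w b y := by
  have : erIoo (x : EReal) b = Ioc x y ∪ erIoo (y : EReal) b := by
    ext t
    simp only [erIoo, mem_ofPred_eq, mem_union, mem_Ioc, EReal.coe_lt_coe_iff]
    constructor
    · rintro ⟨h1, h2⟩
      rcases le_or_gt t y with h3 | h3
      · exact Or.inl ⟨h1, h3⟩
      · exact Or.inr ⟨h3, h2⟩
    · rintro (⟨h1, h2⟩ | ⟨h1, h2⟩)
      · exact ⟨h1, lt_of_le_of_lt (by exact_mod_cast h2) hy⟩
      · exact ⟨h.trans_lt h1, h2⟩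
  rw [Wf, this, lintegral_union (measurableSet_erIoo _ _)]
  · rfl
  · rw [Set.disjoint_left]
    rintro t h1 h2
    have := h2.1
    simp only [EReal.coe_lt_coe_iff] at this
    exact absurd h1.2 (not_le.2 this)

lemma lint_pos_of_ae {a b : EReal} {w : ℝ → ℝ≥0∞} (hw : Measurable w)
    (hpos : ∀ᵐ t ∂(volume.restrict (erIoo a b)), 0 < w t) {x y : ℝ} (hxy : x < y)
    (h1 : a ≤ x) (h2 : (y : EReal) ≤ b) : 0 < ∫⁻ t in Ioo x y, w t := by
  rw [setLIntegral_pos_iff hw]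
  have h3 : ∀ᵐ t ∂(volume.restrict (Ioo x y)), 0 < w t :=
    ae_restrict_of_ae_restrict_of_subset (Ioo_subset_erIoo h1 h2) hpos
  have : volume (Function.support w ∩ Ioo x y) = volume (Ioo x y) := by
    apply measure_congr
    have := (ae_restrict_iff' measurableSet_Ioo).1 h3
    filter_upwards [this] with t ht
    apply propext
    constructor
    · exact fun h => h.2
    · exact fun h => ⟨(ht h).ne', h⟩
  rw [this]; simp [hxy]

lemma Wf_strict {a b : EReal} {w : ℝ → ℝ≥0∞} (hw : Measurable w)
    (hpos : ∀ᵐ t ∂(volume.restrict (erIoo a b)), 0 < w t) {x y : ℝ} (hxy : x < y)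
    (h1 : a ≤ x) (h2 : (y : EReal) < b) (hfin : Wf w b y < ∞) : Wf w b y < Wf w b x := by
  rw [Wf_split w b hxy.le h2, lint_Ioc_Ioo, add_comm]
  exact ENNReal.lt_add_right hfin.ne (lint_pos_of_ae hw hpos hxy h1 h2.le).ne'

lemma Wf_pos {a b : EReal} {w : ℝ → ℝ≥0∞} (hw : Measurable w)
    (hpos : ∀ᵐ t ∂(volume.restrict (erIoo a b)), 0 < w t) {x : ℝ}
    (h1 : a ≤ x) (h2 : (x : EReal) < b) : 0 < Wf w b x := by
  obtain ⟨y, hy1, hy2⟩ := exists_mem_erIoo h2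
  refine (lint_pos_of_ae hw hpos (x := x) (y := y) (by exact_mod_cast hy1) h1 hy2.le).trans_le ?_
  exact lintegral_mono_set (Ioo_subset_erIoo le_rfl hy2.le)

/-- Right continuity of the tail. -/
lemma Wf_right {b : EReal} {w : ℝ → ℝ≥0∞} {x : ℝ} {c : ℝ≥0∞} (h : c < Wf w b x) :
    ∃ y, y ∈ erIoo (x : EReal) b ∧ c < Wf w b y := by
  let ι := {q : ℚ // ((q : ℝ) : ℝ) ∈ erIoo (x : EReal) b}
  have hU : erIoo (x : EReal) b = ⋃ q : ι, erIoo (((q.1 : ℝ)) : EReal) b := by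
    ext t
    simp only [mem_iUnion]
    constructor
    · intro ht
      obtain ⟨q, h1, h2⟩ := exists_rat_btwn (show x < t by exact_mod_cast ht.1)
      exact ⟨⟨q, by exact_mod_cast h1, lt_trans (by exact_mod_cast h2) ht.2⟩,
        by exact_mod_cast h2, ht.2⟩
    · rintro ⟨q, hq⟩
      exact ⟨q.2.1.trans hq.1, hq.2⟩
  have hd : Directed (· ⊆ ·) (fun q : ι => erIoo (((q.1 : ℝ)) : EReal) b) := by
    intro p q
    rcases le_total p.1 q.1 with h | h
    · exact ⟨p, subset_rfl, erIoo_subset (by exact_mod_cast h) le_rfl⟩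
    · exact ⟨q, erIoo_subset (by exact_mod_cast h) le_rfl, subset_rfl⟩
  rw [Wf, hU, setLIntegral_iUnion_of_directed _ hd, lt_iSup_iff] at h
  obtain ⟨q, hq⟩ := h
  exact ⟨_, q.2, hq⟩

/-- The tail tends to zero. -/
lemma Wf_zero {b : EReal} {w : ℝ → ℝ≥0∞} {x : ℝ} {c : ℝ≥0∞} (hx : (x : EReal) < b)
    (hfin : Wf w b x < ∞) (hc : 0 < c) :
    ∃ y, y ∈ erIoo (x : EReal) b ∧ Wf w b y < c := by
  by_contra! hcon
  let ι := {q : ℚ // ((q : ℝ) : ℝ) ∈ erIoo (x : EReal) b}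
  have hU : erIoo (x : EReal) b = ⋃ q : ι, Ioc x (q.1 : ℝ) := by
    ext t
    simp only [mem_iUnion]
    constructor
    · intro ht
      obtain ⟨q, h1, h2⟩ := EReal.lt_iff_exists_rat_btwn.1 ht.2
      exact ⟨⟨q, ht.1.trans h1, h2⟩, by exact_mod_cast ht.1, by exact_mod_cast h1.le⟩
    · rintro ⟨q, hq⟩
      exact ⟨by exact_mod_cast hq.1, lt_of_le_of_lt (by exact_mod_cast hq.2) q.2.2⟩
  have hd : Directed (· ⊆ ·) (fun q : ι => Ioc x (q.1 : ℝ)) := by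
    intro p q
    rcases le_total p.1 q.1 with h | h
    · exact ⟨q, Ioc_subset_Ioc_right (by exact_mod_cast h), subset_rfl⟩
    · exact ⟨p, subset_rfl, Ioc_subset_Ioc_right (by exact_mod_cast h)⟩
  have : Nonempty ι := by
    obtain ⟨q, h1, h2⟩ := EReal.lt_iff_exists_rat_btwn.1 hx
    exact ⟨⟨q, h1, h2⟩⟩
  have h1 : Wf w b x = ⨆ q : ι, ∫⁻ t in Ioc x (q.1 : ℝ), w t := by
    rw [← setLIntegral_iUnion_of_directed _ hd, ← hU, Wf]
  have h2 : Wf w b x + c ≤ Wf w b x := by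
    conv_lhs => rw [h1]
    rw [ENNReal.iSup_add]
    refine iSup_le fun q => ?_
    rw [Wf_split w b (x := x) (y := (q.1 : ℝ)) (by exact_mod_cast q.2.1.le) q.2.2]
    gcongr
    exact hcon _ q.2
  exact absurd h2 (not_le.2 (ENNReal.lt_add_right hfin.ne hc.ne'))

lemma Wf_left {b : EReal} {w : ℝ → ℝ≥0∞} {x0 x : ℝ} {c : ℝ≥0∞} (hx : x0 < x) (hxb : (x : EReal) < b)
    (hfin : Wf w b x0 < ∞) (hc : Wf w b x < c) :
    ∃ y, y ∈ Ioo x0 x ∧ Wf w b y < c := by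
  have hf2 : Wf w (x : EReal) x0 < ∞ :=
    lt_of_le_of_lt (lintegral_mono_set (erIoo_subset le_rfl hxb.le)) hfin
  obtain ⟨y, hy, hy2⟩ := Wf_zero (b := (x : EReal)) (w := w) (x := x0) (c := c - Wf w b x)
    (by exact_mod_cast hx) hf2 (tsub_pos_of_lt hc)
  rw [erIoo_coe] at hy
  refine ⟨y, hy, ?_⟩
  rw [Wf_split w b hy.2.le hxb, lint_Ioc_Ioo, ← erIoo_coe]
  exact lt_tsub_iff_right.1 hy2

lemma Wf_ivt {a : ℝ} {b : EReal} {w : ℝ → ℝ≥0∞}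
    (hfin : ∀ x ∈ erIoo (a : EReal) b, Wf w b x < ∞) {c : ℝ≥0∞} (hc0 : 0 < c)
    (hc : c < Wf w b a) : ∃ x ∈ erIoo (a : EReal) b, Wf w b x = c := by
  obtain ⟨x0, hx0, hcx0⟩ := Wf_right hc
  obtain ⟨x1, hx1, hcx1⟩ := Wf_zero hx0.2 (hfin x0 hx0) hc0
  have h01 : x0 < x1 := by exact_mod_cast hx1.1
  set A := {t : ℝ | t ∈ Icc x0 x1 ∧ c ≤ Wf w b t} with hA
  have hbdd : BddAbove A := ⟨x1, fun t ht => ht.1.2⟩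
  have hx0A : x0 ∈ A := ⟨⟨le_rfl, h01.le⟩, hcx0.le⟩
  set s := sSup A
  have hs0 : x0 ≤ s := le_csSup hbdd hx0A
  have hs1 : s ≤ x1 := csSup_le ⟨x0, hx0A⟩ fun t ht => ht.1.2
  have hsb : (s : EReal) < b := lt_of_le_of_lt (by exact_mod_cast hs1) hx1.2
  have hsI : s ∈ erIoo (a : EReal) b := ⟨hx0.1.trans_le (by exact_mod_cast hs0), hsb⟩
  refine ⟨s, hsI, le_antisymm ?_ ?_⟩
  · by_contra! hlt
    obtain ⟨y, hy, hcy⟩ := Wf_right hlt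
    have hsy : s < y := by exact_mod_cast hy.1
    have hy1 : y ≤ x1 := by
      by_contra! h
      exact absurd (hcy.trans_le (Wf_anti w b h.le)) (not_lt.2 hcx1.le)
    exact absurd (le_csSup hbdd (show y ∈ A from ⟨⟨hs0.trans hsy.le, hy1⟩, hcy.le⟩)) (not_le.2 hsy)
  · by_contra! hlt
    have hs0' : x0 < s := by
      rcases hs0.lt_or_eq with h | h
      · exact h
      · rw [← h] at hlt; exact absurd hcx0 (not_lt.2 hlt.le)
    obtain ⟨y, hy, hcy⟩ := Wf_left hs0' hsb (hfin x0 hx0) hlt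
    obtain ⟨t, htA, hyt⟩ := exists_lt_of_lt_csSup ⟨x0, hx0A⟩ hy.2
    exact absurd (htA.2.trans (Wf_anti w b hyt.le)) (not_le.2 hcy)

lemma exists_dyadic {c : ℝ≥0∞} (h0 : 0 < c) (h1 : c < ∞) :
    ∃ k : ℤ, tp (k : ℝ) < c ∧ c ≤ tp ((k : ℝ) + 1) := by
  have hc : 0 < c.toReal := ENNReal.toReal_pos h0.ne' h1.ne
  obtain ⟨k, hk1, hk2⟩ := exists_mem_Ioc_zpow hc (show (1 : ℝ) < 2 by norm_num)
  have e : ∀ j : ℤ, tp (j : ℝ) = ENNReal.ofReal ((2 : ℝ) ^ j) := by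
    intro j
    rw [← Real.rpow_intCast, ← ENNReal.ofReal_rpow_of_pos (by norm_num), tp]
    simp
  refine ⟨k, ?_, ?_⟩
  · rw [e]; exact (ENNReal.ofReal_lt_iff_lt_toReal (by positivity) h1.ne).2 hk1
  · have : (k : ℝ) + 1 = ((k + 1 : ℤ) : ℝ) := by push_cast; rfl
    rw [this, e]; exact (ENNReal.le_ofReal_iff_toReal_le h1.ne (by positivity)).2 hk2

lemma dyadic {a : ℝ} {b : EReal} {w : ℝ → ℝ≥0∞} (hab : (a : EReal) < b) (hw : Measurable w)
    (hpos : ∀ᵐ t ∂(volume.restrict (erIoo (a : EReal) b)), 0 < w t)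
    (hfin : ∀ x ∈ erIoo (a : EReal) b, Wf w b x < ∞) :
    ∃ x : ℤ → ℝ, Monotone x ∧ (∀ k, a ≤ x k ∧ (x k : EReal) < b) ∧
      (∀ t ∈ erIoo (a : EReal) b, ∃ k : ℤ, t ∈ Ioc (x k) (x (k + 1))) ∧
      (∀ k : ℤ, Wf w b (x k) ≤ tp (-(k : ℝ))) ∧
      (∀ k : ℤ, x k < x (k + 1) → (∀ t ≤ x (k + 2), tp (-(k : ℝ) - 2) ≤ Wf w b t) ∧
        ∫⁻ t in Ioo (x (k + 1)) (x (k + 2)), w t = tp (-(k : ℝ) - 2)) := by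
  have H : ∀ k : ℤ, ∃ x : ℝ, (a ≤ x ∧ (x : EReal) < b) ∧
      Wf w b x = min (tp (-(k : ℝ))) (Wf w b a) := by
    intro k
    by_cases h : tp (-(k : ℝ)) < Wf w b a
    · obtain ⟨x, hx, hxc⟩ := Wf_ivt hfin (tp_pos _) h
      exact ⟨x, ⟨by exact_mod_cast hx.1.le, hx.2⟩, by rw [hxc, min_eq_left h.le]⟩
    · exact ⟨a, ⟨le_rfl, hab⟩, by rw [min_eq_right (not_lt.1 h)]⟩
  choose x hx hW using H
  have hstrict : ∀ {s t : ℝ}, a ≤ s → s < t → (t : EReal) < b → Wf w b t < Wf w b s := by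
    intro s t h1 h2 h3
    exact Wf_strict hw hpos h2 (by exact_mod_cast h1) h3
      (hfin t ⟨lt_of_le_of_lt (by exact_mod_cast h1) (by exact_mod_cast h2 : (s : EReal) < t), h3⟩)
  have hmono : Monotone x := by
    intro k l hkl
    by_contra! h
    have h1 := hstrict (hx l).1 h (hx k).2
    rw [hW, hW] at h1
    refine absurd h1 (not_lt.2 (min_le_min_right _ (tp_mono ?_)))
    have : (k : ℝ) ≤ l := by exact_mod_cast hkl
    linarith
  have key : ∀ k : ℤ, x k < x (k + 1) → ∀ l : ℤ, k + 1 ≤ l → Wf w b (x l) = tp (-(l : ℝ)) := by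
    intro k hk l hl
    have h1 := hstrict (hx k).1 hk (hx _).2
    rw [hW (k + 1)] at h1
    have h2 : tp (-((k + 1 : ℤ) : ℝ)) < Wf w b a := by
      by_contra! h
      rw [min_eq_right h] at h1
      exact absurd (Wf_anti w b (hx k).1) (not_le.2 h1)
    rw [hW, min_eq_left]
    refine le_trans (tp_mono ?_) h2.le
    have : ((k + 1 : ℤ) : ℝ) ≤ l := by exact_mod_cast hl
    linarith
  refine ⟨x, hmono, hx, ?_, fun k => by rw [hW]; exact min_le_left _ _, ?_⟩
  · intro t ht
    have hat : a < t := by exact_mod_cast ht.1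
    have hWt : 0 < Wf w b t := Wf_pos hw hpos ht.1.le ht.2
    obtain ⟨j, hj1, hj2⟩ := exists_dyadic (c := (Wf w b t)⁻¹) (by simp [(hfin t ht).ne])
      (by simp [hWt])
    refine ⟨j, ?_, ?_⟩
    · by_contra! h
      have h1 := Wf_anti w b h
      rw [hW] at h1
      have h2 : Wf w b t < tp (-(j : ℝ)) := by
        rw [tp_neg]; exact (ENNReal.lt_inv_iff_lt_inv).2 hj1
      exact absurd h1 (not_le.2 (lt_min h2 (hstrict le_rfl hat ht.2)))
    · by_contra! h
      have h1 := hstrict (hx _).1 h ht.2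
      rw [hW] at h1
      have h2 : tp (-((j + 1 : ℤ) : ℝ)) ≤ Wf w b t := by
        rw [tp_neg]; push_cast
        exact (ENNReal.inv_le_iff_inv_le).2 hj2
      exact absurd (h1.trans_le (min_le_left _ _)) (not_lt.2 h2)
  · intro k hk
    have h1 := key k hk (k + 1) le_rfl
    have h2 := key k hk (k + 2) (by omega)
    have e2 : tp (-((k + 2 : ℤ) : ℝ)) = tp (-(k : ℝ) - 2) := by congr 1; push_cast; ring
    have e1 : tp (-((k + 1 : ℤ) : ℝ)) = tp (-(k : ℝ) - 2) + tp (-(k : ℝ) - 2) := by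
      rw [← two_mul, ← tp_one, ← tp_add]; congr 1; push_cast; ring
    refine ⟨fun t ht => ?_, ?_⟩
    · rw [← e2, ← h2]; exact Wf_anti w b ht
    · have h3 := Wf_split w b (hmono (show k + 1 ≤ k + 2 by omega)) (hx _).2
      rw [h1, h2, e1, e2, lint_Ioc_Ioo] at h3
      exact ((ENNReal.add_left_inj (tp_ne_top _)).1 h3).symm

lemma Vr_mono {r : ℝ} (hr : 0 < r) (hr1 : r ≤ 1) (v : ℝ → ℝ≥0∞) {x x' : ℝ} {y y' : EReal}
    (hx : x' ≤ x) (hy : y ≤ y') : Vr r v x y ≤ Vr r v x' y' := by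
  have hs : erIoo (x : EReal) y ⊆ erIoo (x' : EReal) y' :=
    erIoo_subset (by exact_mod_cast hx) hy
  unfold Vr
  split_ifs with h
  · exact essSup_mono_measure' (Measure.restrict_mono hs le_rfl)
  · refine ENNReal.rpow_le_rpow (lintegral_mono_set hs) ?_
    apply div_nonneg _ hr.le
    linarith

lemma Vr_pos {r : ℝ} (hr : 0 < r) (hr1 : r ≤ 1) {a b : EReal} {v : ℝ → ℝ≥0∞} (hv : Measurable v)
    (hpos : ∀ᵐ t ∂(volume.restrict (erIoo a b)), 0 < v t) {x y : ℝ} (hxy : x < y)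
    (h1 : a ≤ x) (h2 : (y : EReal) ≤ b) : 0 < Vr r v x (y : EReal) := by
  unfold Vr
  rw [erIoo_coe]
  have hp := lint_pos_of_ae hv hpos hxy h1 h2
  have h3 : ∀ᵐ t ∂(volume.restrict (Ioo x y)), 0 < v t :=
    ae_restrict_of_ae_restrict_of_subset (Ioo_subset_erIoo h1 h2) hpos
  split_ifs with h
  · rw [pos_iff_ne_zero]
    intro h0
    rw [ENNReal.essSup_eq_zero_iff] at h0
    rw [lintegral_congr_ae h0] at hp
    simp at hp
  · have hr1' : r < 1 := lt_of_le_of_ne hr1 h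
    have h4 : 0 < ∫⁻ s in Ioo x y, v s ^ (1 / (1 - r)) := by
      refine lint_pos_of_ae (a := (x : EReal)) (b := (y : EReal)) (hv.pow_const _) ?_ hxy le_rfl le_rfl
      rw [erIoo_coe]
      filter_upwards [h3] with t ht
      rcases eq_or_ne (v t) ∞ with h | h
      · rw [h, ENNReal.top_rpow_of_pos]
        · simp
        · apply one_div_pos.2; linarith
      · exact ENNReal.rpow_pos ht h
    rcases eq_or_ne (∫⁻ s in Ioo x y, v s ^ (1 / (1 - r))) ∞ with h5 | h5
    · rw [h5, ENNReal.top_rpow_of_pos]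
      · simp
      · apply div_pos _ hr; linarith
    · exact ENNReal.rpow_pos h4 h5

lemma Vr_holder {r : ℝ} (hr : 0 < r) (hr1 : r ≤ 1) {v f : ℝ → ℝ≥0∞} (hv : Measurable v)
    (hf : Measurable f) (s t : ℝ) :
    (∫⁻ τ in Ioo s t, f τ ^ r * v τ) ^ (1 / r) ≤ (∫⁻ τ in Ioo s t, f τ) * Vr r v s (t : EReal) := by
  unfold Vr
  rw [erIoo_coe]
  split_ifs with h
  · subst h
    simp only [ENNReal.rpow_one, div_one]
    rw [← lintegral_mul_const _ hf]
    refine lintegral_mono_ae ?_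
    filter_upwards [ENNReal.ae_le_essSup (μ := volume.restrict (Ioo s t)) v] with τ hτ
    gcongr
  · have hr1' : 0 < 1 - r := by
      have := lt_of_le_of_ne hr1 h
      linarith
    have hc : (1 / r).HolderConjugate (1 / (1 - r)) := by
      rw [Real.holderConjugate_iff]
      constructor
      · rw [lt_div_iff₀ hr]; linarith
      · simp
    have := ENNReal.lintegral_mul_le_Lp_mul_Lq (volume.restrict (Ioo s t)) hc
      (f := fun τ => f τ ^ r) (g := v) (hf.pow_const _).aemeasurable hv.aemeasurable
    simp only [Pi.mul_apply, ← ENNReal.rpow_mul, one_div_one_div] at this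
    have h1 : r * (1 / r) = 1 := by field_simp
    simp only [h1, ENNReal.rpow_one] at this
    calc _ ≤ _ := ENNReal.rpow_le_rpow this (by positivity)
      _ = _ := by
        rw [ENNReal.mul_rpow_of_nonneg _ _ (by positivity), ← ENNReal.rpow_mul, ← ENNReal.rpow_mul,
          h1, ENNReal.rpow_one]
        congr 2
        field_simp

/-- Near-extremal functions for `V_r`. -/
lemma Vr_ext {r : ℝ} (hr : 0 < r) (hr1 : r ≤ 1) {a b : EReal} {v : ℝ → ℝ≥0∞} (hv : Measurable v)
    (hfin : ∀ᵐ t ∂(volume.restrict (erIoo a b)), v t < ∞) {x y : ℝ}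
    (h1 : a ≤ x) (h2 : (y : EReal) ≤ b) {c : ℝ≥0∞} (hc : c < Vr r v x (y : EReal)) :
    ∃ h : ℝ → ℝ≥0∞, Measurable h ∧ (∫⁻ t, h t ≤ 1) ∧ (∀ t, t ∉ Ioo x y → h t = 0) ∧
      c ^ r ≤ ∫⁻ t in Ioo x y, h t ^ r * v t := by
  have h3 : ∀ᵐ t ∂(volume.restrict (Ioo x y)), v t < ∞ :=
    ae_restrict_of_ae_restrict_of_subset (Ioo_subset_erIoo h1 h2) hfin
  unfold Vr at hc
  rw [erIoo_coe] at hc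
  split_ifs at hc with h
  · subst h
    set A := Ioo x y ∩ {t | c < v t} with hA
    have hAm : MeasurableSet A := measurableSet_Ioo.inter (measurableSet_lt measurable_const hv)
    have hA0 : volume A ≠ 0 := by
      intro h0
      refine absurd (essSup_le_of_ae_le c ?_) (not_le.2 hc)
      rw [Filter.EventuallyLE, ae_restrict_iff' measurableSet_Ioo, ae_iff]
      convert h0 using 2
      ext t
      simp [hA]
      tauto
    have hAt : volume A ≠ ∞ :=
      ne_of_lt (lt_of_le_of_lt (measure_mono inter_subset_left) (by simp))
    refine ⟨A.indicator (fun _ => (volume A)⁻¹), measurable_const.indicator hAm, ?_, ?_, ?_⟩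
    · rw [lintegral_indicator hAm, setLIntegral_const, ENNReal.inv_mul_cancel hA0 hAt]
    · intro t ht
      exact indicator_of_notMem (fun h => ht h.1) _
    · simp only [ENNReal.rpow_one]
      calc c = ∫⁻ t in A, (volume A)⁻¹ * c := by
            rw [setLIntegral_const, mul_right_comm, ENNReal.inv_mul_cancel hA0 hAt, one_mul]
        _ ≤ ∫⁻ t in A, A.indicator (fun _ => (volume A)⁻¹) t * v t := by
            refine setLIntegral_mono' hAm fun t ht => ?_
            rw [indicator_of_mem ht]
            gcongr
            exact ht.2.le
        _ ≤ _ := lintegral_mono_set inter_subset_left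
  · have hr1' : 0 < 1 - r := by
      have := lt_of_le_of_ne hr1 h
      linarith
    set e := 1 / (1 - r) with he
    have he0 : 0 < e := one_div_pos.2 hr1'
    let A : ℕ → Set ℝ := fun n => Ioo x y ∩ {t | v t ≤ n}
    have hAm : ∀ n, MeasurableSet (A n) := fun n =>
      measurableSet_Ioo.inter (measurableSet_le hv measurable_const)
    have hAmono : Monotone A := by
      intro n m hnm t ht
      exact ⟨ht.1, le_trans (show v t ≤ (n : ℝ≥0∞) from ht.2)
        (by exact_mod_cast hnm : (n : ℝ≥0∞) ≤ m)⟩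
    have hsup : ∫⁻ s in Ioo x y, v s ^ e = ⨆ n, ∫⁻ s in A n, v s ^ e := by
      rw [← setLIntegral_iUnion_of_directed _ hAmono.directed_le]
      apply setLIntegral_congr
      rw [ae_restrict_iff' measurableSet_Ioo] at h3
      filter_upwards [h3] with t ht
      apply propext
      constructor
      · intro hm
        obtain ⟨n, hn⟩ := ENNReal.exists_nat_gt (ht hm).ne
        exact mem_iUnion.2 ⟨n, hm, hn.le⟩
      · intro hm
        obtain ⟨n, hn⟩ := mem_iUnion.1 hm
        exact hn.1
    have hex : 0 < (1 - r) / r := div_pos hr1' hr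
    have hc' : c ^ (r / (1 - r)) < ∫⁻ s in Ioo x y, v s ^ e := by
      have hinv : (1 - r) / r * (r / (1 - r)) = 1 := by field_simp
      have := ENNReal.rpow_lt_rpow hc (show 0 < r / (1 - r) by positivity)
      rwa [← ENNReal.rpow_mul, hinv, ENNReal.rpow_one] at this
    rw [hsup, lt_iSup_iff] at hc'
    obtain ⟨n, hn⟩ := hc'
    set B := ∫⁻ s in A n, v s ^ e with hB
    have hB0 : B ≠ 0 := (bot_le.trans_lt hn).ne'
    have hBt : B ≠ ∞ := by
      refine ne_of_lt (lt_of_le_of_lt (setLIntegral_mono' (g := fun _ => (n : ℝ≥0∞) ^ e) (hAm n)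
        fun t ht => ENNReal.rpow_le_rpow ht.2 he0.le) ?_)
      rw [setLIntegral_const]
      refine ENNReal.mul_lt_top (ENNReal.rpow_lt_top_of_nonneg he0.le (by simp)) ?_
      exact lt_of_le_of_lt (measure_mono inter_subset_left) (by simp)
    refine ⟨(A n).indicator (fun t => B⁻¹ * v t ^ e),
      ((hv.pow_const _).const_mul _).indicator (hAm n), ?_, ?_, ?_⟩
    · rw [lintegral_indicator (hAm n), lintegral_const_mul _ (hv.pow_const _),
        ENNReal.inv_mul_cancel hB0 hBt]
    · intro t ht
      exact indicator_of_notMem (fun h => ht h.1) _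
    · calc c ^ r = (c ^ (r / (1 - r))) ^ (1 - r) := by
            rw [← ENNReal.rpow_mul]; congr 1; field_simp
        _ ≤ B ^ (1 - r) := ENNReal.rpow_le_rpow hn.le hr1'.le
        _ = (B⁻¹) ^ r * B := by
            rw [ENNReal.inv_rpow, ENNReal.rpow_sub _ _ hB0 hBt, ENNReal.rpow_one,
              ENNReal.div_eq_inv_mul]
        _ = ∫⁻ t in A n, (B⁻¹) ^ r * v t ^ e := by
            rw [lintegral_const_mul _ (hv.pow_const _)]
        _ ≤ ∫⁻ t in A n, (A n).indicator (fun t => B⁻¹ * v t ^ e) t ^ r * v t := by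
            refine setLIntegral_mono' (hAm n) fun t ht => ?_
            rw [indicator_of_mem ht, ENNReal.mul_rpow_of_nonneg _ _ hr.le, mul_assoc,
              ← ENNReal.rpow_mul]
            gcongr
            have hvt : v t ≠ ∞ := ne_of_lt (lt_of_le_of_lt ht.2 (by simp))
            have : e = e * r + 1 := by rw [he]; field_simp; ring
            conv_lhs => rw [this]
            rw [ENNReal.rpow_add_of_nonneg _ _ (by positivity) (by norm_num), ENNReal.rpow_one]
        _ ≤ _ := lintegral_mono_set inter_subset_left

lemma essSup_exists {a x : ℝ} {φ : ℝ → ℝ≥0∞} {c : ℝ≥0∞}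
    (h : c < essSup φ (volume.restrict (Ioo a x))) : ∃ t ∈ Ioo a x, c < φ t := by
  by_contra! hcon
  refine absurd (essSup_le_of_ae_le c ?_) (not_le.2 h)
  rw [Filter.EventuallyLE, ae_restrict_iff' measurableSet_Ioo]
  exact Filter.Eventually.of_forall hcon

/-- The essential supremum dominates pointwise values for `W^{-σ} X` with `X` antitone. -/
lemma le_essSup_of {a : ℝ} {b : EReal} {w : ℝ → ℝ≥0∞}
    (hfin : ∀ x ∈ erIoo (a : EReal) b, 0 < Wf w b x ∧ Wf w b x < ∞) {σ : ℝ} (hσ : 0 < σ)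
    {X : ℝ → ℝ≥0∞} {y x : ℝ} (hay : a < y) (hyx : y < x) (hyb : (y : EReal) < b)
    (hX : ∀ y' ∈ Ioo a y, X y ≤ X y') :
    tp (-σ) * (Wf w b y ^ (-σ) * X y) ≤
      essSup (fun y => Wf w b y ^ (-σ) * X y) (volume.restrict (Ioo a x)) := by
  set M := essSup (fun y => Wf w b y ^ (-σ) * X y) (volume.restrict (Ioo a x)) with hM
  have hWy := hfin y ⟨by exact_mod_cast hay, hyb⟩
  have step : ∀ c, Wf w b y < c → c ^ (-σ) * X y ≤ M := by
    intro c hc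
    obtain ⟨x0, hx0a, hx0y⟩ := exists_between hay
    obtain ⟨z, hz, hzc⟩ := Wf_left hx0y hyb
      (hfin x0 ⟨by exact_mod_cast hx0a, lt_trans (by exact_mod_cast hx0y) hyb⟩).2 hc
    by_contra! hlt
    have h1 : ∀ᵐ t ∂(volume.restrict (Ioo a x)), Wf w b t ^ (-σ) * X t ≤ M :=
      ENNReal.ae_le_essSup _
    have h2 : ∀ᵐ t ∂(volume.restrict (Ioo z y)), Wf w b t ^ (-σ) * X t ≤ M :=
      ae_restrict_of_ae_restrict_of_subset
        (Ioo_subset_Ioo (hx0a.trans hz.1).le hyx.le) h1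
    have h3 : ∀ᵐ t ∂(volume.restrict (Ioo z y)), False := by
      filter_upwards [h2, ae_restrict_mem measurableSet_Ioo] with t ht htm
      refine absurd (ht.trans_lt hlt) (not_lt.2 ?_)
      refine mul_le_mul' ?_ (hX t ⟨(hx0a.trans hz.1).trans htm.1, htm.2⟩)
      rw [ENNReal.rpow_neg, ENNReal.rpow_neg]
      exact ENNReal.inv_le_inv.2
        (ENNReal.rpow_le_rpow ((Wf_anti w b htm.1.le).trans hzc.le) hσ.le)
    rw [Filter.eventually_false_iff_eq_bot, ae_eq_bot, Measure.restrict_eq_zero] at h3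
    simp at h3
    exact absurd h3 (not_le.2 hz.2)
  have h2 : Wf w b y < 2 * Wf w b y := by
    rw [two_mul]
    exact ENNReal.lt_add_right hWy.2.ne hWy.1.ne'
  have h3 := step _ h2
  rwa [ENNReal.mul_rpow_of_ne_top (by simp) hWy.2.ne, mul_assoc] at h3

lemma Ioc_blocks_disj {x : ℤ → ℝ} (hx : Monotone x) :
    Pairwise (Function.onFun Disjoint fun k : ℤ => Ioc (x k) (x (k + 1))) := by
  have := hx.pairwise_disjoint_on_Ioc_succ
  simpa [Order.succ_eq_add_one] using this

/-- sum of integrals over blocks is at most the whole integral -/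
lemma sum_blocks_le {a : ℝ} {b : EReal} {x : ℤ → ℝ} (hx : Monotone x)
    (hxab : ∀ k, a ≤ x k ∧ (x k : EReal) < b) (μ : Measure ℝ) (f : ℝ → ℝ≥0∞) :
    ∑' k : ℤ, ∫⁻ t in Ioc (x k) (x (k + 1)), f t ∂μ ≤ ∫⁻ t in erIoo (a : EReal) b, f t ∂μ := by
  rw [← lintegral_iUnion (fun _ => measurableSet_Ioc) (Ioc_blocks_disj hx)]
  refine lintegral_mono_set (iUnion_subset fun k => ?_)
  exact Ioc_subset_erIoo (by exact_mod_cast (hxab k).1) (hxab (k + 1)).2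

lemma le_sum_blocks {a : ℝ} {b : EReal} {x : ℤ → ℝ}
    (hcov : ∀ t ∈ erIoo (a : EReal) b, ∃ k : ℤ, t ∈ Ioc (x k) (x (k + 1)))
    (μ : Measure ℝ) (f : ℝ → ℝ≥0∞) :
    ∫⁻ t in erIoo (a : EReal) b, f t ∂μ ≤ ∑' k : ℤ, ∫⁻ t in Ioc (x k) (x (k + 1)), f t ∂μ := by
  refine le_trans (lintegral_mono_set (t := ⋃ k : ℤ, Ioc (x k) (x (k + 1))) ?_)
    (lintegral_iUnion_le _ _)
  intro t ht
  exact mem_iUnion.2 (hcov t ht)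

lemma hardy_upper (θ s : ℝ) (hθ : 0 < θ) (hs : 0 < s) (hs1 : s < 1) :
    ∃ C : ℝ≥0∞, C < ∞ ∧ ∀ (a : ℝ) (b : EReal), (a : EReal) < b → ∀ u : ℝ → ℝ≥0∞, Measurable u →
      (∀ᵐ t ∂(volume.restrict (erIoo (a : EReal) b)), 0 < u t) → ∀ (μ ν : Measure ℝ)
      (g : ℝ → ℝ≥0∞), MonotoneOn g (erIoo (a : EReal) b) → (∀ t ∈ erIoo (a : EReal) b, 0 < g t) →
      (∀ s' t, a ≤ s' → s' < t → t ∈ erIoo (a : EReal) b →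
        μ (Ioc s' t) ^ θ ≤ ν (Ioc s' t) * g t) →
      ∫⁻ t in erIoo (a : EReal) b, μ (Ioc a t) ^ (θ * s) * u t ≤
        C * ν (erIoo (a : EReal) b) ^ s *
          (∫⁻ t in erIoo (a : EReal) b, Wf u b t ^ (s / (1 - s)) * u t * g t ^ (s / (1 - s)))
            ^ (1 - s) := by
  obtain ⟨C1, hC1, hgeo⟩ := geo_sum (θ * s) (by positivity)
  have h1s : 0 < 1 - s := by linarith
  set κ := s / (1 - s) with hκ
  have hκ0 : 0 < κ := by positivity
  refine ⟨C1 * tp 2 + 1, by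
    exact ENNReal.add_lt_top.2 ⟨ENNReal.mul_lt_top hC1 (tp_lt_top _), by simp⟩, ?_⟩
  intro a b hab u hu hupos μ ν g hg hgpos H
  set I := erIoo (a : EReal) b with hI
  by_cases hfin : ∀ x ∈ I, Wf u b x < ∞
  swap
  · push Not at hfin
    obtain ⟨x, hxI, hx⟩ := hfin
    have hax : a < x := by exact_mod_cast hxI.1
    rw [top_le_iff] at hx
    rcases eq_or_ne (ν I) 0 with h0 | h0
    · have : ∀ t ∈ I, μ (Ioc a t) ^ (θ * s) * u t = 0 := by
        intro t ht
        have h1 := H a t le_rfl (by exact_mod_cast ht.1) ht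
        have h2 : ν (Ioc a t) = 0 :=
          le_antisymm ((measure_mono (Ioc_subset_erIoo le_rfl ht.2)).trans h0.le) bot_le
        rw [h2, zero_mul, nonpos_iff_eq_zero, ENNReal.rpow_eq_zero_iff_of_pos hθ] at h1
        rw [h1, ENNReal.zero_rpow_of_pos (by positivity), zero_mul]
      rw [setLIntegral_congr_fun (measurableSet_erIoo _ _) this]
      simp
    · have h1 : ∫⁻ t in I, Wf u b t ^ κ * u t * g t ^ κ = ∞ := by
        rw [← top_le_iff]
        calc (∞ : ℝ≥0∞) = ∫⁻ t in Ioo a x, ∞ := by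
              rw [setLIntegral_const, Real.volume_Ioo, ENNReal.top_mul]
              simpa using hax
          _ ≤ ∫⁻ t in Ioo a x, Wf u b t ^ κ * u t * g t ^ κ := by
              refine lintegral_mono_ae ?_
              have h3 : ∀ᵐ t ∂(volume.restrict (Ioo a x)), 0 < u t :=
                ae_restrict_of_ae_restrict_of_subset (Ioo_subset_erIoo le_rfl hxI.2.le) hupos
              filter_upwards [h3, ae_restrict_mem measurableSet_Ioo] with t ht htm
              have h4 : Wf u b t = ∞ := by
                rw [← top_le_iff, ← hx]; exact Wf_anti u b htm.2.le
              rw [h4, ENNReal.top_rpow_of_pos hκ0, ENNReal.top_mul ht.ne', ENNReal.top_mul]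
              have := hgpos t (Ioo_subset_erIoo le_rfl hxI.2.le htm)
              intro h5
              rw [ENNReal.rpow_eq_zero_iff_of_pos hκ0] at h5
              exact this.ne' h5
          _ ≤ _ := lintegral_mono_set (Ioo_subset_erIoo le_rfl hxI.2.le)
      rw [h1, ENNReal.top_rpow_of_pos h1s, ENNReal.mul_top]
      · exact le_top
      · refine mul_ne_zero (by simp) ?_
        intro h5
        rw [ENNReal.rpow_eq_zero_iff_of_pos hs] at h5
        exact h0 h5
  obtain ⟨x, hxm, hxab, hcov, hW, hnd⟩ := dyadic hab hu hupos hfin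
  set m : ℤ → ℝ≥0∞ := fun k => μ (Ioc (x k) (x (k + 1))) with hm
  set n : ℤ → ℝ≥0∞ := fun k => ν (Ioc (x k) (x (k + 1))) with hn
  set Φ : ℝ → ℝ≥0∞ := fun t => Wf u b t ^ κ * u t * g t ^ κ with hΦ
  set Y : ℤ → ℝ≥0∞ := fun k => ∫⁻ t in Ioc (x (k + 1)) (x (k + 1 + 1)), Φ t with hY
  have hYsum : ∑' k, Y k ≤ ∫⁻ t in I, Φ t := by
    have := sum_blocks_le (x := fun k => x (k + 1)) (a := a) (b := b)
      (fun i j h => hxm (by omega)) (fun k => hxab (k + 1)) volume Φ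
    exact this
  have hnsum : ∑' k, n k ≤ ν I := by
    have := sum_blocks_le hxm hxab ν (fun _ => 1)
    simpa using this
  have hstep1 : ∫⁻ t in I, μ (Ioc a t) ^ (θ * s) * u t ≤
      ∑' k : ℤ, tp (-(k : ℝ)) * (∑' i : ℕ, m (k - i)) ^ (θ * s) := by
    refine (le_sum_blocks hcov volume _).trans (ENNReal.tsum_le_tsum fun k => ?_)
    calc ∫⁻ t in Ioc (x k) (x (k + 1)), μ (Ioc a t) ^ (θ * s) * u t
        ≤ ∫⁻ t in Ioc (x k) (x (k + 1)), (∑' i : ℕ, m (k - i)) ^ (θ * s) * u t := by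
          refine setLIntegral_mono' measurableSet_Ioc fun t ht => ?_
          gcongr
          refine (measure_mono (t := ⋃ i : ℕ, Ioc (x (k - i)) (x (k - i + 1))) ?_).trans
            (measure_iUnion_le _)
          intro τ hτ
          have hτI : τ ∈ I := Ioc_subset_erIoo le_rfl
            (lt_of_le_of_lt (by exact_mod_cast ht.2) (hxab (k + 1)).2) hτ
          obtain ⟨j, hj⟩ := hcov τ hτI
          have hjk : j < k + 1 := by
            by_contra! hcon
            exact absurd (hj.1.trans_le (hτ.2.trans ht.2)) (not_lt.2 (hxm hcon))
          refine mem_iUnion.2 ⟨(k - j).toNat, ?_⟩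
          have : k - ((k - j).toNat : ℤ) = j := by omega
          rw [this]; exact hj
      _ = (∑' i : ℕ, m (k - i)) ^ (θ * s) * ∫⁻ t in Ioc (x k) (x (k + 1)), u t :=
          lintegral_const_mul _ hu
      _ ≤ (∑' i : ℕ, m (k - i)) ^ (θ * s) * tp (-(k : ℝ)) := by
          gcongr
          exact (lintegral_mono_set (Ioc_subset_erIoo le_rfl (hxab (k + 1)).2)).trans (hW k)
      _ = _ := mul_comm _ _
  have hterm : ∀ k : ℤ, tp (-(k : ℝ)) * m k ^ (θ * s) ≤ tp 2 * (n k ^ s * Y k ^ (1 - s)) := by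
    intro k
    rcases (hxm (show k ≤ k + 1 by omega)).eq_or_lt with heq | hlt
    · have : m k = 0 := by simp [hm, heq]
      rw [this, ENNReal.zero_rpow_of_pos (by positivity), mul_zero]; exact bot_le
    obtain ⟨h1, h2⟩ := hnd k hlt
    have hk2 : k + 1 + 1 = k + 2 := by ring
    have hxI : x (k + 1) ∈ I :=
      ⟨by exact_mod_cast (hxab k).1.trans_lt hlt, (hxab (k + 1)).2⟩
    have h3 : m k ^ (θ * s) ≤ n k ^ s * g (x (k + 1)) ^ s := by
      rw [ENNReal.rpow_mul, ← ENNReal.mul_rpow_of_nonneg _ _ hs.le]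
      exact ENNReal.rpow_le_rpow (H _ _ (hxab k).1 hlt hxI) hs.le
    have h4 : tp ((-(k : ℝ) - 2) * κ) * g (x (k + 1)) ^ κ * tp (-(k : ℝ) - 2) ≤ Y k := by
      calc _ = ∫⁻ t in Ioc (x (k + 1)) (x (k + 2)),
              tp ((-(k : ℝ) - 2) * κ) * g (x (k + 1)) ^ κ * u t := by
            rw [lintegral_const_mul _ hu, lint_Ioc_Ioo, h2]
        _ ≤ Y k := by
            rw [hY]; simp only [hk2]
            refine setLIntegral_mono' measurableSet_Ioc fun t ht => ?_
            have htI : t ∈ I := Ioc_subset_erIoo (by exact_mod_cast (hxab _).1) (hxab _).2 ht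
            rw [hΦ]; simp only
            rw [mul_right_comm, ← tp_rpow]
            gcongr
            · exact h1 t ht.2
            · exact hg hxI htI ht.1.le
    have h5 : tp (-(k : ℝ) - 2) * g (x (k + 1)) ^ s ≤ Y k ^ (1 - s) := by
      refine le_trans (le_of_eq ?_) (ENNReal.rpow_le_rpow h4 h1s.le)
      rw [ENNReal.mul_rpow_of_nonneg _ _ h1s.le, ENNReal.mul_rpow_of_nonneg _ _ h1s.le, tp_rpow,
        tp_rpow, ← ENNReal.rpow_mul, mul_right_comm, ← tp_add]
      congr 2
      · rw [hκ]; field_simp; ring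
      · rw [hκ]; field_simp
    calc tp (-(k : ℝ)) * m k ^ (θ * s) ≤ tp (-(k : ℝ)) * (n k ^ s * g (x (k + 1)) ^ s) := by gcongr
      _ = tp 2 * (n k ^ s * (tp (-(k : ℝ) - 2) * g (x (k + 1)) ^ s)) := by
          have : tp (-(k : ℝ)) = tp 2 * tp (-(k : ℝ) - 2) := by
            rw [← tp_add]; congr 1; ring
          rw [this]; ring
      _ ≤ _ := by gcongr
  calc _ ≤ _ := hstep1
    _ ≤ C1 * ∑' k : ℤ, tp (-(k : ℝ)) * m k ^ (θ * s) := hgeo m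
    _ ≤ C1 * ∑' k : ℤ, tp 2 * (n k ^ s * Y k ^ (1 - s)) := by
        exact mul_le_mul' le_rfl (ENNReal.tsum_le_tsum hterm)
    _ = C1 * tp 2 * ∑' k : ℤ, (n k ^ s * Y k ^ (1 - s)) := by rw [ENNReal.tsum_mul_left, mul_assoc]
    _ ≤ C1 * tp 2 * ((∑' k, n k) ^ s * (∑' k, Y k) ^ (1 - s)) := by
        gcongr; exact holder_tsum s hs hs1 n Y
    _ ≤ (C1 * tp 2 + 1) * (ν I ^ s * (∫⁻ t in I, Φ t) ^ (1 - s)) := by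
        gcongr
        exact le_self_add
    _ = _ := by rw [mul_assoc]

/-- inner integral of `C₅` -/
noncomputable def Bf (q r : ℝ) (u v : ℝ → ℝ≥0∞) (y x : ℝ) : ℝ≥0∞ :=
  ∫⁻ t in Set.Ioo y x, (∫⁻ s in Set.Ioo t x, u s) ^ (q / (1 - q)) * u t *
                  Vr r v y ((t : ℝ) : EReal) ^ (q / (1 - q))

noncomputable def G4 (p q r a : ℝ) (b : EReal) (v w : ℝ → ℝ≥0∞) (x : ℝ) : ℝ≥0∞ :=
  essSup (fun t => Wf w b t ^ (-(q / (p - q))) *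
            Vr r v t ((x : ℝ) : EReal) ^ (p * q / (p - q)))
          (volume.restrict (Set.Ioo a x))

noncomputable def G5 (p q r a : ℝ) (b : EReal) (u v w : ℝ → ℝ≥0∞) (x : ℝ) : ℝ≥0∞ :=
  essSup (fun y => Wf w b y ^ (-(p / (p - q))) * Bf q r u v y x ^ (p * (1 - q) / (p - q)))
        (volume.restrict (Set.Ioo a x))

lemma C4_eq (p q r a : ℝ) (b : EReal) (u v w : ℝ → ℝ≥0∞) : C4const p q r a b u v w =
  (∫⁻ x in erIoo (a : EReal) b, Wf u b x ^ (q / (p - q)) * u x * G4 p q r a b v w x)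
    ^ ((p - q) / (p * q)) := rfl

lemma C5_eq (p q r a : ℝ) (b : EReal) (u v w : ℝ → ℝ≥0∞) : C5const p q r a b u v w =
  (∫⁻ x in erIoo (a : EReal) b, w x * G5 p q r a b u v w x) ^ ((p - q) / (p * q)) := rfl

lemma Bf_mono {q r : ℝ} (hr : 0 < r) (hr1 : r ≤ 1) (hq : 0 < q) (hq1 : q < 1) (u v : ℝ → ℝ≥0∞)
    {y y' x x' : ℝ} (hy : y' ≤ y) (hx : x ≤ x') : Bf q r u v y x ≤ Bf q r u v y' x' := by
  have h1q : 0 < 1 - q := by linarith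
  unfold Bf
  refine le_trans (setLIntegral_mono' measurableSet_Ioo fun t ht => ?_)
    (lintegral_mono_set (Ioo_subset_Ioo hy hx))
  gcongr
  exact Vr_mono hr hr1 v hy le_rfl

lemma G4_mono {p q r a : ℝ} {b : EReal} (hr : 0 < r) (hr1 : r ≤ 1) (hq : 0 < q) (hqp : q < p)
    (v w : ℝ → ℝ≥0∞) : Monotone (G4 p q r a b v w) := by
  intro x x' hx
  have h : 0 < p - q := by linarith
  have hp : 0 < p := by linarith
  unfold G4
  refine le_trans (essSup_mono_ae (Filter.Eventually.of_forall fun t => ?_))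
    (essSup_mono_measure' (Measure.restrict_mono (Ioo_subset_Ioo le_rfl hx) le_rfl))
  dsimp only
  gcongr
  exact Vr_mono hr hr1 v le_rfl (by exact_mod_cast hx)

lemma G5_mono {p q r a : ℝ} {b : EReal} (hr : 0 < r) (hr1 : r ≤ 1) (hq : 0 < q) (hqp : q < p)
    (hp1 : p ≤ 1) (u v w : ℝ → ℝ≥0∞) : Monotone (G5 p q r a b u v w) := by
  intro x x' hx
  have h : 0 < p - q := by linarith
  have hp : 0 < p := by linarith
  have h1q : 0 < 1 - q := by linarith
  unfold G5
  refine le_trans (essSup_mono_ae (Filter.Eventually.of_forall fun t => ?_))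
    (essSup_mono_measure' (Measure.restrict_mono (Ioo_subset_Ioo le_rfl hx) le_rfl))
  dsimp only
  gcongr
  exact Bf_mono hr hr1 hq (by linarith) u v le_rfl hx

/-- Local upper bound on one block. -/
lemma block_upper (q r : ℝ) (hq : 0 < q) (hq1 : q < 1) (hr : 0 < r) (hr1 : r ≤ 1) :
    ∃ C : ℝ≥0∞, C < ∞ ∧ ∀ (a : ℝ) (b : EReal) (u v : ℝ → ℝ≥0∞), Measurable u → Measurable v →
      (∀ᵐ t ∂(volume.restrict (erIoo (a : EReal) b)), 0 < u t) →
      (∀ᵐ t ∂(volume.restrict (erIoo (a : EReal) b)), 0 < v t) →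
      ∀ (f : ℝ → ℝ≥0∞), Measurable f → ∀ c d : ℝ, c < d → a ≤ c → (d : EReal) ≤ b →
      ∫⁻ t in Ioo c d, (∫⁻ s in Ioo c t, f s ^ r * v s) ^ (q / r) * u t ≤
        C * (∫⁻ t in Ioo c d, f t) ^ q * Bf q r u v c d ^ (1 - q) := by
  obtain ⟨C, hC, H⟩ := hardy_upper (1 / r) q (by positivity) hq hq1
  refine ⟨C, hC, ?_⟩
  intro a b u v hu hv hupos hvpos f hf c d hcd hac hdb
  have hsub := Ioo_subset_erIoo (x := c) (y := d) (a := (a : EReal)) (b := b)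
    (by exact_mod_cast hac) hdb
  have h := H c (d : EReal) (by exact_mod_cast hcd) u hu (by
    rw [erIoo_coe]; exact ae_restrict_of_ae_restrict_of_subset hsub hupos)
    (volume.withDensity fun t => f t ^ r * v t) (volume.withDensity f)
    (fun t => Vr r v c (t : EReal)) (fun s _ t _ hst => Vr_mono hr hr1 v le_rfl
      (by exact_mod_cast hst)) (by
      rw [erIoo_coe]
      intro t ht
      exact Vr_pos hr hr1 hv hvpos ht.1 (by exact_mod_cast hac)
        (le_trans (by exact_mod_cast ht.2.le) hdb)) (by
      intro s' t hs' hst ht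
      rw [withDensity_apply _ measurableSet_Ioc, withDensity_apply _ measurableSet_Ioc,
        lint_Ioc_Ioo, lint_Ioc_Ioo]
      refine (Vr_holder hr hr1 hv hf s' t).trans ?_
      gcongr
      exact Vr_mono hr hr1 v hs' le_rfl)
  rw [erIoo_coe, withDensity_apply _ measurableSet_Ioo] at h
  refine le_trans (le_of_eq ?_) (h.trans (le_of_eq ?_))
  · refine setLIntegral_congr_fun measurableSet_Ioo fun t ht => ?_
    rw [withDensity_apply _ measurableSet_Ioc, lint_Ioc_Ioo]
    congr 2
    field_simp
  · unfold Bf Wf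
    simp only [erIoo_coe]

lemma sum_dirac_apply (m : ℤ → ℝ≥0∞) (x : ℤ → ℝ) {S : Set ℝ} (hS : MeasurableSet S) :
    (Measure.sum fun j => m j • Measure.dirac (x j)) S = ∑' j, m j * S.indicator 1 (x j) := by
  rw [Measure.sum_apply _ hS]
  refine tsum_congr fun j => ?_
  simp [Measure.dirac_apply' _ hS]

lemma upper_trunc (p q r : ℝ) (hq : 0 < q) (hqp : q < p) (hpr : p ≤ r) (hr1 : r ≤ 1) :
    ∃ C : ℝ≥0∞, C < ∞ ∧ ∀ (a : ℝ) (b : EReal) (u v w : ℝ → ℝ≥0∞), Measurable u → Measurable v →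
      Measurable w →
      (∀ᵐ t ∂(volume.restrict (erIoo (a : EReal) b)), 0 < u t) →
      (∀ᵐ t ∂(volume.restrict (erIoo (a : EReal) b)), 0 < v t) →
      (∀ᵐ t ∂(volume.restrict (erIoo (a : EReal) b)), 0 < w t) →
      (∀ x : ℝ, x ∈ erIoo (a : EReal) b → 0 < Wf w b x ∧ Wf w b x < ∞) →
      ∀ (f : ℝ → ℝ≥0∞), Measurable f → ∀ a' ∈ erIoo (a : EReal) b,
      ∫⁻ t in erIoo (a' : EReal) b, (∫⁻ s in Ioo a' t, f s ^ r * v s) ^ (q / r) * u t ≤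
        C * (∫⁻ t in erIoo (a : EReal) b, (∫⁻ s in Set.Ioo a t, f s) ^ p * w t) ^ (q / p) *
          (C4const p q r a b u v w ^ q + C5const p q r a b u v w ^ q) := by
  have hp : 0 < p := by linarith
  have hr : 0 < r := by linarith
  have hp1 : p ≤ 1 := by linarith
  have hq1 : q < 1 := by linarith
  have hpq : 0 < p - q := by linarith
  have h1q : 0 < 1 - q := by linarith
  have hs1 : q / p < 1 := by rw [div_lt_one hp]; exact hqp
  obtain ⟨C1, hC1, H1⟩ := hardy_upper (p / r) (q / p) (by positivity) (by positivity) hs1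
  obtain ⟨C2, hC2, H2⟩ := block_upper q r hq hq1 hr hr1
  set κ := q / (p - q) with hκ
  set σ := p / (p - q) with hσ
  have hκ0 : 0 < κ := by positivity
  have hσ0 : 0 < σ := by positivity
  refine ⟨tp (q / r) * (C1 * tp (3 * (q / p)) +
    C2 * tp (2 * (q / p)) * tp ((σ + 2) * (1 - q / p))), ?_, ?_⟩
  · refine ENNReal.mul_lt_top (tp_lt_top _) (ENNReal.add_lt_top.2 ⟨?_, ?_⟩)
    · exact ENNReal.mul_lt_top hC1 (tp_lt_top _)
    · exact ENNReal.mul_lt_top (ENNReal.mul_lt_top hC2 (tp_lt_top _)) (tp_lt_top _)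
  intro a b u v w hu hv hw hup hvp hwp hWfin f hf a' ha'
  have haa' : a < a' := by exact_mod_cast ha'.1
  have hI' : erIoo (a' : EReal) b ⊆ erIoo (a : EReal) b := erIoo_subset ha'.1.le le_rfl
  set I' := erIoo (a' : EReal) b with hI'def
  set I := erIoo (a : EReal) b with hIdef
  have hup' := ae_restrict_of_ae_restrict_of_subset hI' hup
  have hwp' := ae_restrict_of_ae_restrict_of_subset hI' hwp
  obtain ⟨x, hxm, hxab, hcov, hW, hnd⟩ := dyadic ha'.2 hw hwp' (fun t ht => (hWfin t (hI' ht)).2)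
  have hxI : ∀ k, x k ∈ I := fun k => ⟨by exact_mod_cast haa'.trans_le (hxab k).1, (hxab k).2⟩
  set R := ∫⁻ t in I, (∫⁻ s in Set.Ioo a t, f s) ^ p * w t with hR
  set F : ℤ → ℝ≥0∞ := fun k => ∫⁻ t in Ioc (x k) (x (k + 1)), f t with hF
  set m : ℤ → ℝ≥0∞ := fun k => ∫⁻ t in Ioc (x k) (x (k + 1)), f t ^ r * v t with hm
  have hk2 : ∀ k : ℤ, k + 1 + 1 = k + 2 := fun k => by ring
  -- bound on R
  have hRF : ∑' k : ℤ, F k ^ p * tp (-(k : ℝ)) ≤ tp 2 * R := by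
    have h1 := sum_blocks_le (x := fun k => x (k + 1)) (a := a) (b := b)
      (fun i j h => hxm (by omega)) (fun k => ⟨by exact_mod_cast (hxI (k + 1)).1.le, (hxab (k + 1)).2⟩)
      volume (fun t => (∫⁻ s in Set.Ioo a t, f s) ^ p * w t)
    refine le_trans ?_ (mul_le_mul' le_rfl h1)
    rw [← ENNReal.tsum_mul_left]
    refine ENNReal.tsum_le_tsum fun k => ?_
    rcases (hxm (show k ≤ k + 1 by omega)).eq_or_lt with heq | hlt
    · have : F k = 0 := by simp [hF, heq]
      rw [this, ENNReal.zero_rpow_of_pos hp, zero_mul]; exact bot_le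
    obtain ⟨-, h2⟩ := hnd k hlt
    have e : tp (-(k : ℝ)) = tp 2 * tp (-(k : ℝ) - 2) := by rw [← tp_add]; congr 1; ring
    rw [e, mul_left_comm]
    refine mul_le_mul' le_rfl ?_
    rw [hk2, ← h2, ← lint_Ioc_Ioo, ← lintegral_const_mul _ hw]
    refine setLIntegral_mono' measurableSet_Ioc fun t ht => ?_
    gcongr
    rw [hF]; simp only
    rw [lint_Ioc_Ioo]
    exact lintegral_mono_set (Ioo_subset_Ioo (by exact_mod_cast (hxI k).1.le) ht.1.le)
  -- Part I
  set μ : Measure ℝ := Measure.sum fun j => m j • Measure.dirac (x (j + 1)) with hμ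
  set N : ℤ → ℝ≥0∞ := fun j => tp 1 * (F j ^ p * tp (-(j : ℝ))) with hN
  set ν : Measure ℝ := Measure.sum fun j => N j • Measure.dirac (x (j + 1)) with hν
  have hGge : ∀ y t : ℝ, a < y → y < t → (t : EReal) < b →
      tp (-κ) * (Wf w b y ^ (-κ) * Vr r v y (t : EReal) ^ (p * q / (p - q))) ≤
        G4 p q r a b v w t := by
    intro y t hay hyt htb
    refine le_essSup_of (X := fun y => Vr r v y (t : EReal) ^ (p * q / (p - q))) hWfin hκ0 hay hyt
      (lt_trans (by exact_mod_cast hyt) htb) fun y' hy' => ?_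
    refine ENNReal.rpow_le_rpow (Vr_mono hr hr1 v hy'.2.le le_rfl) (by positivity)
  have hGpos : ∀ t ∈ I', 0 < G4 p q r a b v w t := by
    intro t ht
    have hat : a' < t := by exact_mod_cast ht.1
    refine lt_of_lt_of_le ?_ (hGge a' t haa' hat ht.2)
    have h1 := Vr_pos hr hr1 hv hvp hat ha'.1.le ht.2.le
    have hex : 0 < p * q / (p - q) := by positivity
    refine ENNReal.mul_pos (tp_ne_zero _) (mul_ne_zero ?_ ?_)
    · rw [ENNReal.rpow_neg]
      exact ENNReal.inv_ne_zero.2 (ENNReal.rpow_ne_top_of_nonneg hκ0.le (hWfin a' ha').2.ne)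
    · intro h; rw [ENNReal.rpow_eq_zero_iff_of_pos hex] at h; exact h1.ne' h
  have hpart1 : ∫⁻ t in I', μ (Ioc a' t) ^ (q / r) * u t ≤
      C1 * (tp 3 * R) ^ (q / p) * C4const p q r a b u v w ^ q := by
    have h := H1 a' b ha'.2 u hu hup' μ ν (fun t => G4 p q r a b v w t ^ (1 / κ))
      (fun s _ t _ hst => ENNReal.rpow_le_rpow (G4_mono hr hr1 hq hqp v w hst) (by positivity))
      (fun t ht => by
        have h1 := hGpos t ht
        rw [pos_iff_ne_zero]
        intro h2
        rw [ENNReal.rpow_eq_zero_iff_of_pos (by positivity)] at h2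
        exact h1.ne' h2)
      (by
        intro s' t hs' hst ht
        rw [hμ, hν, sum_dirac_apply m _ measurableSet_Ioc, sum_dirac_apply N _ measurableSet_Ioc]
        refine (tsum_rpow_le _ (by positivity) (by rw [div_le_one hr]; exact hpr) _).trans ?_
        rw [← ENNReal.tsum_mul_right]
        refine ENNReal.tsum_le_tsum fun j => ?_
        by_cases hj : x (j + 1) ∈ Ioc s' t
        swap
        · rw [indicator_of_notMem hj, mul_zero, ENNReal.zero_rpow_of_pos (by positivity)]
          exact bot_le
        rw [indicator_of_mem hj, Pi.one_apply, mul_one, mul_one]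
        rcases (hxm (show j ≤ j + 1 by omega)).eq_or_lt with heq | hlt
        · have : m j = 0 := by simp [hm, heq]
          rw [this, ENNReal.zero_rpow_of_pos (by positivity)]; exact bot_le
        have h1 : m j ^ (p / r) ≤ F j ^ p * Vr r v (x j) (t : EReal) ^ p := by
          have h2 := Vr_holder hr hr1 hv hf (x j) (x (j + 1))
          rw [← lint_Ioc_Ioo, ← lint_Ioc_Ioo] at h2
          have e : p / r = 1 / r * p := by ring
          rw [e, ENNReal.rpow_mul, ← ENNReal.mul_rpow_of_nonneg _ _ hp.le]
          refine ENNReal.rpow_le_rpow (h2.trans ?_) hp.le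
          gcongr
          exact Vr_mono hr hr1 v le_rfl (by exact_mod_cast hj.2)
        have h3 : Vr r v (x j) (t : EReal) ^ p ≤
            tp 1 * tp (-(j : ℝ)) * G4 p q r a b v w t ^ (1 / κ) := by
          have h4 := hGge (x j) t (by exact_mod_cast (hxI j).1) (hlt.trans_le hj.2) ht.2
          have h5 := ENNReal.rpow_le_rpow h4 (show 0 ≤ 1 / κ by positivity)
          have hk1 : -κ * (1 / κ) = -1 := by field_simp
          have hk3 : p * q / (p - q) * (1 / κ) = p := by rw [hκ]; field_simp
          rw [ENNReal.mul_rpow_of_nonneg _ _ (by positivity),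
            ENNReal.mul_rpow_of_nonneg _ _ (by positivity), tp_rpow, ← ENNReal.rpow_mul,
            ← ENNReal.rpow_mul, hk1, hk3, ENNReal.rpow_neg_one] at h5
          have hw0 := hWfin (x j) (hxI j)
          calc Vr r v (x j) (t : EReal) ^ p = (tp 1 * tp (-1)) * (Wf w b (x j) *
                (Wf w b (x j))⁻¹) * Vr r v (x j) (t : EReal) ^ p := by
                rw [ENNReal.mul_inv_cancel hw0.1.ne' hw0.2.ne, tp_mul_neg, one_mul, one_mul]
            _ = tp 1 * Wf w b (x j) * (tp (-1) * ((Wf w b (x j))⁻¹ *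
                  Vr r v (x j) (t : EReal) ^ p)) := by ring
            _ ≤ _ := by gcongr; exact hW j
        calc _ ≤ _ := h1
          _ ≤ F j ^ p * (tp 1 * tp (-(j : ℝ)) * G4 p q r a b v w t ^ (1 / κ)) := by gcongr
          _ = _ := by rw [hN]; ring)
    have e1 : p / r * (q / p) = q / r := by field_simp
    have e2 : q / p / (1 - q / p) = κ := by rw [hκ]; field_simp
    have e3 : ∀ t, (G4 p q r a b v w t ^ (1 / κ)) ^ κ = G4 p q r a b v w t := fun t => by
      rw [← ENNReal.rpow_mul, one_div, inv_mul_cancel₀ hκ0.ne', ENNReal.rpow_one]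
    rw [e1, e2] at h
    simp only [e3] at h
    refine h.trans ?_
    gcongr
    · rw [hν, sum_dirac_apply _ _ (measurableSet_erIoo _ _)]
      calc ∑' j, N j * (erIoo (a' : EReal) b).indicator 1 (x (j + 1)) ≤ ∑' j, N j := by
            refine ENNReal.tsum_le_tsum fun j => ?_
            by_cases hj : x (j + 1) ∈ erIoo (a' : EReal) b
            · rw [indicator_of_mem hj]; simp
            · rw [indicator_of_notMem hj]; simp
        _ = tp 1 * ∑' j : ℤ, F j ^ p * tp (-(j : ℝ)) := by rw [ENNReal.tsum_mul_left]
        _ ≤ tp 1 * (tp 2 * R) := by gcongr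
        _ = tp 3 * R := by rw [← mul_assoc, ← tp_add]; norm_num
    · rw [C4_eq, ← ENNReal.rpow_mul]
      have e4 : (p - q) / (p * q) * q = 1 - q / p := by field_simp
      rw [e4]
      refine ENNReal.rpow_le_rpow (lintegral_mono_set hI') (by linarith)
  -- Part II
  set Y : ℤ → ℝ≥0∞ := fun k => ∫⁻ t in Ioc (x (k + 1)) (x (k + 1 + 1)),
    w t * G5 p q r a b u v w t with hY
  have hYsum : ∑' k, Y k ≤ ∫⁻ t in I, w t * G5 p q r a b u v w t :=
    sum_blocks_le (x := fun k => x (k + 1)) (a := a) (b := b)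
      (fun i j h => hxm (by omega)) (fun k => ⟨by exact_mod_cast (hxI (k + 1)).1.le, (hxab (k + 1)).2⟩)
      volume _
  have hpart2 : ∑' k : ℤ, ∫⁻ t in Ioc (x k) (x (k + 1)),
      (∫⁻ s in Ioo (x k) t, f s ^ r * v s) ^ (q / r) * u t ≤
      C2 * tp ((σ + 2) * (1 - q / p)) * (tp 2 * R) ^ (q / p) * C5const p q r a b u v w ^ q := by
    have hterm : ∀ k : ℤ, ∫⁻ t in Ioc (x k) (x (k + 1)),
        (∫⁻ s in Ioo (x k) t, f s ^ r * v s) ^ (q / r) * u t ≤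
        C2 * tp ((σ + 2) * (1 - q / p)) * ((F k ^ p * tp (-(k : ℝ))) ^ (q / p) *
          Y k ^ (1 - q / p)) := by
      intro k
      rcases (hxm (show k ≤ k + 1 by omega)).eq_or_lt with heq | hlt
      · rw [← heq]; simp
      obtain ⟨-, h2⟩ := hnd k hlt
      have hB := H2 a b u v hu hv hup hvp f hf (x k) (x (k + 1)) hlt
        (by exact_mod_cast (hxI k).1.le) (hxab (k + 1)).2.le
      rw [← lint_Ioc_Ioo, ← lint_Ioc_Ioo] at hB
      refine hB.trans ?_
      set e := p * (1 - q) / (p - q) with he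
      have he0 : 0 < e := by positivity
      set B := Bf q r u v (x k) (x (k + 1)) with hBdef
      have hYk : tp (-σ) * tp (k * σ) * B ^ e * tp (-(k : ℝ) - 2) ≤ Y k := by
        rw [hY]; simp only [hk2]
        rw [← h2, ← lint_Ioc_Ioo, ← lintegral_const_mul _ hw]
        refine setLIntegral_mono' measurableSet_Ioc fun t ht => ?_
        rw [mul_comm (w t)]
        refine mul_le_mul' ?_ le_rfl
        have htb : (t : EReal) < b := lt_of_le_of_lt (by exact_mod_cast ht.2) (hxab _).2
        have h5 : tp (-σ) * (Wf w b (x k) ^ (-σ) * Bf q r u v (x k) t ^ e) ≤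
            G5 p q r a b u v w t := by
          refine le_essSup_of (X := fun y => Bf q r u v y t ^ e) hWfin hσ0
            (by exact_mod_cast (hxI k).1) (hlt.trans ht.1) (hxab k).2 fun y' hy' => ?_
          exact ENNReal.rpow_le_rpow (Bf_mono hr hr1 hq hq1 u v hy'.2.le le_rfl) he0.le
        refine le_trans ?_ h5
        rw [mul_assoc]
        gcongr
        · rw [ENNReal.rpow_neg]
          have : tp (k * σ) = (tp (-(k : ℝ)) ^ σ)⁻¹ := by
            rw [tp_rpow, ← tp_neg]; congr 1; ring
          rw [this]
          exact ENNReal.inv_le_inv.2 (ENNReal.rpow_le_rpow (hW k) hσ0.le)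
        · exact Bf_mono hr hr1 hq hq1 u v le_rfl ht.1.le
      have h6 := ENNReal.rpow_le_rpow hYk (show 0 ≤ 1 - q / p by linarith)
      have e5 : e * (1 - q / p) = 1 - q := by rw [he]; field_simp
      have hs0 : 0 ≤ 1 - q / p := by linarith
      rw [ENNReal.mul_rpow_of_nonneg _ _ hs0, ENNReal.mul_rpow_of_nonneg _ _ hs0,
        ENNReal.mul_rpow_of_nonneg _ _ hs0, tp_rpow, tp_rpow, tp_rpow, ← ENNReal.rpow_mul, e5] at h6
      have e6 : F k ^ q = (F k ^ p * tp (-(k : ℝ))) ^ (q / p) * tp (k * (q / p)) := by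
        rw [ENNReal.mul_rpow_of_nonneg _ _ (by positivity), tp_rpow, ← ENNReal.rpow_mul, mul_assoc,
          ← tp_add]
        have : p * (q / p) = q := by field_simp
        rw [this]
        have : -(k : ℝ) * (q / p) + k * (q / p) = 0 := by ring
        rw [this, tp_zero, mul_one]
      calc C2 * F k ^ q * B ^ (1 - q)
          = C2 * tp ((σ + 2) * (1 - q / p)) * ((F k ^ p * tp (-(k : ℝ))) ^ (q / p) *
            (tp (-σ * (1 - q / p)) * tp (k * σ * (1 - q / p)) * B ^ (1 - q) *
              tp ((-(k : ℝ) - 2) * (1 - q / p)))) := by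
            rw [e6]
            have : tp (k * (q / p)) = tp ((σ + 2) * (1 - q / p)) * tp (-σ * (1 - q / p)) *
                tp (k * σ * (1 - q / p)) * tp ((-(k : ℝ) - 2) * (1 - q / p)) := by
              rw [← tp_add, ← tp_add, ← tp_add]; congr 1
              rw [hσ]; field_simp; ring
            rw [this]; ring
        _ ≤ _ := by gcongr
    calc _ ≤ _ := ENNReal.tsum_le_tsum hterm
      _ = C2 * tp ((σ + 2) * (1 - q / p)) * ∑' k : ℤ, ((F k ^ p * tp (-(k : ℝ))) ^ (q / p) *
          Y k ^ (1 - q / p)) := by rw [ENNReal.tsum_mul_left]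
      _ ≤ C2 * tp ((σ + 2) * (1 - q / p)) * ((∑' k : ℤ, F k ^ p * tp (-(k : ℝ))) ^ (q / p) *
          (∑' k, Y k) ^ (1 - q / p)) := by
          gcongr
          exact holder_tsum _ (by positivity) hs1 _ _
      _ ≤ C2 * tp ((σ + 2) * (1 - q / p)) * ((tp 2 * R) ^ (q / p) *
          (∫⁻ t in I, w t * G5 p q r a b u v w t) ^ (1 - q / p)) := by
          have hs0 : 0 ≤ 1 - q / p := by linarith
          gcongr
      _ = _ := by
          rw [C5_eq, ← ENNReal.rpow_mul]
          have e4 : (p - q) / (p * q) * q = 1 - q / p := by field_simp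
          rw [e4]; ring
  -- combine
  have hcomb : ∫⁻ t in I', (∫⁻ s in Ioo a' t, f s ^ r * v s) ^ (q / r) * u t ≤
      tp (q / r) * ((∫⁻ t in I', μ (Ioc a' t) ^ (q / r) * u t) +
        ∑' k : ℤ, ∫⁻ t in Ioc (x k) (x (k + 1)),
          (∫⁻ s in Ioo (x k) t, f s ^ r * v s) ^ (q / r) * u t) := by
    have hmeas : Measurable fun t => μ (Ioc a' t) ^ (q / r) * u t := by
      have : Monotone fun t => μ (Ioc a' t) := fun s t hst =>
        measure_mono (Ioc_subset_Ioc le_rfl hst)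
      exact (this.measurable.pow_const _).mul hu
    have h1 : ∫⁻ t in I', (∫⁻ s in Ioo a' t, f s ^ r * v s) ^ (q / r) * u t ≤
        ∑' k : ℤ, ∫⁻ t in Ioc (x k) (x (k + 1)), tp (q / r) * (μ (Ioc a' t) ^ (q / r) * u t +
          (∫⁻ s in Ioo (x k) t, f s ^ r * v s) ^ (q / r) * u t) := by
      refine (le_sum_blocks hcov volume _).trans (ENNReal.tsum_le_tsum fun k => ?_)
      refine setLIntegral_mono' measurableSet_Ioc fun t ht => ?_
      rw [← add_mul, ← mul_assoc]
      refine mul_le_mul' (le_trans ?_ (add_rpow_le _ (by positivity) _ _)) le_rfl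
      refine ENNReal.rpow_le_rpow ?_ (by positivity)
      have hset : Ioo a' t ⊆ (⋃ j : {j : ℤ // j < k}, Ioc (x j) (x (j + 1))) ∪ Ioo (x k) t := by
        intro τ hτ
        rcases lt_or_ge (x k) τ with h | h
        · exact Or.inr ⟨h, hτ.2⟩
        left
        obtain ⟨j, hj⟩ := hcov τ ⟨by exact_mod_cast hτ.1,
          lt_of_le_of_lt (by exact_mod_cast h) (hxab k).2⟩
        refine mem_iUnion.2 ⟨⟨j, ?_⟩, hj⟩
        by_contra! hcon
        exact absurd (hj.1.trans_le h) (not_lt.2 (hxm hcon))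
      refine (lintegral_mono_set hset).trans ((lintegral_union_le _ _ _).trans ?_)
      refine add_le_add ((lintegral_iUnion_le _ _).trans ?_) le_rfl
      rw [hμ, sum_dirac_apply m _ measurableSet_Ioc]
      refine le_trans (ENNReal.tsum_le_tsum fun j => ?_)
        (ENNReal.tsum_comp_le_tsum_of_injective (Subtype.val_injective (p := fun j : ℤ => j < k)) _)
      rcases (hxm (show (j : ℤ) ≤ j + 1 by omega)).eq_or_lt with heq | hlt
      · rw [← heq]; simp
      rw [indicator_of_mem]
      · simp [hm]
      · have := j.2
        exact ⟨(hxab _).1.trans_lt hlt, (hxm (show (j : ℤ) + 1 ≤ k by omega)).trans ht.1.le⟩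
    refine h1.trans ?_
    have h2 : ∀ k : ℤ, ∫⁻ t in Ioc (x k) (x (k + 1)), tp (q / r) * (μ (Ioc a' t) ^ (q / r) * u t +
          (∫⁻ s in Ioo (x k) t, f s ^ r * v s) ^ (q / r) * u t) =
        tp (q / r) * ((∫⁻ t in Ioc (x k) (x (k + 1)), μ (Ioc a' t) ^ (q / r) * u t) +
         ∫⁻ t in Ioc (x k) (x (k + 1)),
          (∫⁻ s in Ioo (x k) t, f s ^ r * v s) ^ (q / r) * u t) := by
      intro k
      rw [lintegral_const_mul' _ _ (tp_ne_top _), lintegral_add_left hmeas]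
    simp only [h2]
    rw [ENNReal.tsum_mul_left, ENNReal.tsum_add]
    gcongr
    exact sum_blocks_le hxm hxab volume _
  refine hcomb.trans ?_
  rw [mul_assoc (tp (q / r)), mul_assoc (tp (q / r))]
  refine mul_le_mul' le_rfl ?_
  refine (add_le_add hpart1 hpart2).trans ?_
  rw [ENNReal.mul_rpow_of_nonneg _ _ (by positivity), ENNReal.mul_rpow_of_nonneg _ _ (by positivity),
    tp_rpow, tp_rpow]
  set c4 := C4const p q r a b u v w ^ q
  set c5 := C5const p q r a b u v w ^ q
  set A := C1 * tp (3 * (q / p))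
  set B := C2 * tp (2 * (q / p)) * tp ((σ + 2) * (1 - q / p))
  calc _ = A * R ^ (q / p) * c4 + B * R ^ (q / p) * c5 := by ring
    _ ≤ (A + B) * R ^ (q / p) * c4 + (A + B) * R ^ (q / p) * c5 := by
        gcongr
        · exact le_self_add
        · exact le_add_self
    _ = _ := by ring

lemma iSup_rpow' {ι : Sort*} (x : ι → ℝ≥0∞) {γ : ℝ} (hγ : 0 < γ) :
    (⨆ i, x i) ^ γ = ⨆ i, x i ^ γ :=
  (ENNReal.orderIsoRpow γ hγ).map_iSup x

lemma upper_final (p q r : ℝ) (hq : 0 < q) (hqp : q < p) (hpr : p ≤ r) (hr1 : r ≤ 1) :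
    ∃ C : ℝ≥0∞, C < ∞ ∧ ∀ (a : ℝ) (b : EReal) (u v w : ℝ → ℝ≥0∞), (a : EReal) < b → Measurable u →
      Measurable v → Measurable w →
      (∀ᵐ t ∂(volume.restrict (erIoo (a : EReal) b)), 0 < u t) →
      (∀ᵐ t ∂(volume.restrict (erIoo (a : EReal) b)), 0 < v t) →
      (∀ᵐ t ∂(volume.restrict (erIoo (a : EReal) b)), 0 < w t) →
      (∀ x : ℝ, x ∈ erIoo (a : EReal) b → 0 < Wf w b x ∧ Wf w b x < ∞) →
      ∀ (f : ℝ → ℝ≥0∞), Measurable f → mainLHS q r a b u v f ≤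
        C * (C4const p q r a b u v w + C5const p q r a b u v w) * mainRHS p a b w f := by
  obtain ⟨C, hC, H⟩ := upper_trunc p q r hq hqp hpr hr1
  have hp : 0 < p := by linarith
  have hr : 0 < r := by linarith
  refine ⟨(C * 2) ^ (1 / q), ENNReal.rpow_lt_top_of_nonneg (by positivity)
    (ENNReal.mul_ne_top hC.ne (by simp)), ?_⟩
  intro a b u v w hab hu hv hw hup hvp hwp hWfin f hf
  have H := H a b u v w hu hv hw hup hvp hwp hWfin f hf
  obtain ⟨y, hy⟩ := exists_mem_erIoo hab
  obtain ⟨α, hα, hαm, hαt⟩ := exists_seq_strictAnti_tendsto' (show a < y by exact_mod_cast hy.1)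
  set M := C * (∫⁻ t in erIoo (a : EReal) b, (∫⁻ s in Set.Ioo a t, f s) ^ p * w t) ^ (q / p) *
          (C4const p q r a b u v w ^ q + C5const p q r a b u v w ^ q) with hM
  have key : ∫⁻ t in erIoo (a : EReal) b, (∫⁻ s in Ioo a t, f s ^ r * v s) ^ (q / r) * u t ≤ M := by
    have h1 : ∀ t, (∫⁻ s in Ioo a t, f s ^ r * v s) ^ (q / r) * u t =
        ⨆ n, (∫⁻ s in Ioo (α n) t, f s ^ r * v s) ^ (q / r) * u t := by
      intro t
      rw [← ENNReal.iSup_mul, ← iSup_rpow' _ (by positivity),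
        ← setLIntegral_iUnion_of_directed]
      · congr 4
        ext τ
        simp only [mem_Ioo, mem_iUnion]
        constructor
        · rintro ⟨h1, h2⟩
          obtain ⟨n, hn⟩ := (hαt.eventually (gt_mem_nhds h1)).exists
          exact ⟨n, hn, h2⟩
        · rintro ⟨n, h1, h2⟩
          exact ⟨(hαm n).1.trans h1, h2⟩
      · have : Monotone fun n => Ioo (α n) t := fun i j hij =>
          Ioo_subset_Ioo (hα.antitone hij) le_rfl
        exact this.directed_le
    simp only [h1]
    rw [lintegral_iSup]
    · refine iSup_le fun n => ?_
      have hn : α n ∈ erIoo (a : EReal) b :=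
        ⟨by exact_mod_cast (hαm n).1, lt_trans (by exact_mod_cast (hαm n).2) hy.2⟩
      refine le_trans ?_ (H (α n) hn)
      have hsub : erIoo (a : EReal) b ⊆ Iic (α n) ∪ erIoo (α n : EReal) b := by
        intro t ht
        rcases le_or_gt t (α n) with h | h
        · exact Or.inl h
        · exact Or.inr ⟨by exact_mod_cast h, ht.2⟩
      refine (lintegral_mono_set hsub).trans ((lintegral_union_le _ _ _).trans ?_)
      have : ∫⁻ t in Iic (α n), (∫⁻ s in Ioo (α n) t, f s ^ r * v s) ^ (q / r) * u t = 0 := by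
        rw [setLIntegral_congr_fun (g := fun _ => 0) measurableSet_Iic]
        · simp
        · intro t ht
          dsimp only
          rw [Ioo_eq_empty (not_lt.2 ht)]
          simp [ENNReal.zero_rpow_of_pos (show 0 < q / r by positivity)]
      rw [this, zero_add]
    · intro n
      have : Monotone fun t => ∫⁻ s in Ioo (α n) t, f s ^ r * v s := fun s t hst =>
        lintegral_mono_set (Ioo_subset_Ioo le_rfl hst)
      exact (this.measurable.pow_const _).mul hu
    · intro i j hij t
      dsimp only
      gcongr
      exact hα.antitone hij
  unfold mainLHS mainRHS
  calc _ ≤ M ^ (1 / q) := ENNReal.rpow_le_rpow key (by positivity)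
    _ ≤ (C * (∫⁻ t in erIoo (a : EReal) b, (∫⁻ s in Set.Ioo a t, f s) ^ p * w t) ^ (q / p) *
          (2 * (C4const p q r a b u v w + C5const p q r a b u v w) ^ q)) ^ (1 / q) := by
        refine ENNReal.rpow_le_rpow ?_ (by positivity)
        rw [hM, two_mul]
        gcongr
        · exact le_self_add
        · exact le_add_self
    _ = _ := by
        have h0 : 0 ≤ 1 / q := by positivity
        have e1 : q / p * (1 / q) = 1 / p := by field_simp
        have e2 : q * (1 / q) = 1 := by field_simp
        rw [ENNReal.mul_rpow_of_nonneg _ _ h0, ENNReal.mul_rpow_of_nonneg _ _ h0,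
          ENNReal.mul_rpow_of_nonneg _ _ h0, ENNReal.mul_rpow_of_nonneg _ _ h0, ← ENNReal.rpow_mul,
          ← ENNReal.rpow_mul, e1, e2, ENNReal.rpow_one]
        ring

lemma Wf_meas (u : ℝ → ℝ≥0∞) (b : EReal) : Measurable (Wf u b) := by
  have : Antitone (Wf u b) := fun x y h => Wf_anti u b h
  exact this.measurable

lemma lemQ {a : ℝ} {b : EReal} {Λ : Set ℝ} (hΛ : Λ ⊆ erIoo (a : EReal) b) (φ : ℝ → ℝ≥0∞) :
    ∫⁻ t in Λ, φ t ≤ ⨆ z : Λ, ∫⁻ t in erIoo ((z : ℝ) : EReal) b, φ t := by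
  rcases Λ.eq_empty_or_nonempty with h | hne
  · subst h; simp
  have hbdd : BddBelow Λ := ⟨a, fun t ht => by exact_mod_cast (hΛ ht).1.le⟩
  obtain ⟨z, hz, hzt, hzm⟩ := exists_seq_tendsto_sInf hne hbdd
  have hsub : Λ ⊆ {sInf Λ} ∪ ⋃ n, erIoo (z n : EReal) b := by
    intro t ht
    rcases (csInf_le hbdd ht).eq_or_lt with h | h
    · left; exact h.symm
    · right
      obtain ⟨n, hn⟩ := (hzt.eventually (gt_mem_nhds h)).exists
      exact mem_iUnion.2 ⟨n, by exact_mod_cast hn, (hΛ ht).2⟩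
  have hmono : Monotone fun n => erIoo (z n : EReal) b := fun i j hij =>
    erIoo_subset (by exact_mod_cast hz hij) le_rfl
  calc _ ≤ _ := lintegral_mono_set hsub
    _ ≤ _ := lintegral_union_le _ _ _
    _ = ⨆ n, ∫⁻ t in erIoo (z n : EReal) b, φ t := by
        rw [setLIntegral_iUnion_of_directed _ hmono.directed_le]
        simp
    _ ≤ _ := iSup_le fun n => le_iSup_of_le ⟨z n, hzm n⟩ le_rfl

lemma sum_iSup_le (J : Finset ℤ) (Λ : ℤ → Set ℝ) (ψ : ℤ → ℝ → ℝ≥0∞) (M : ℝ≥0∞) :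
    (∀ m ∈ J, (Λ m).Nonempty) → ∀ c : ℝ≥0∞,
    (∀ z : ℤ → ℝ, (∀ m ∈ J, z m ∈ Λ m) → c + ∑ m ∈ J, ψ m (z m) ≤ M) →
      c + ∑ m ∈ J, ⨆ z : Λ m, ψ m z ≤ M := by
  classical
  induction J using Finset.induction_on with
  | empty =>
    intro _ c h
    simpa using h (fun _ => 0) (by simp)
  | insert m0 s hm0 ih =>
    intro hne c h
    rw [Finset.sum_insert hm0, add_left_comm, ← add_assoc, add_assoc]
    have : Nonempty (Λ m0) := (hne m0 (by simp)).to_subtype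
    rw [ENNReal.iSup_add]
    refine iSup_le fun z0 => ?_
    rw [← add_assoc]
    refine ih (fun m hm => hne m (by simp [hm])) _ ?_
    intro z hz
    have h1 := h (Function.update z m0 z0) (by
      intro m hm
      rcases Finset.mem_insert.1 hm with rfl | hm
      · simp
      · have : m ≠ m0 := fun h => hm0 (h ▸ hm)
        simpa [this] using hz m hm)
    rw [Finset.sum_insert hm0, Function.update_self] at h1
    rw [add_comm (ψ m0 z0), add_assoc]
    convert h1 using 3
    refine Finset.sum_congr rfl fun m hm => ?_
    have : m ≠ m0 := fun h => hm0 (h ▸ hm)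
    simp [this]

lemma layers {a : ℝ} {b : EReal} {α φ Ψ : ℝ → ℝ≥0∞} (hα : MonotoneOn α (erIoo (a : EReal) b))
    (hfin : ∀ z ∈ erIoo (a : EReal) b, α z < ∞) {σ : ℝ} (hσ : 0 < σ) (hφ : Measurable φ)
    (hΨ : ∀ z ∈ erIoo (a : EReal) b, ∫⁻ t in erIoo (z : EReal) b, φ t ≤ Ψ z) {M : ℝ≥0∞}
    (H : ∀ (J : Finset ℤ) (z : ℤ → ℝ), (∀ m ∈ J, z m ∈ erIoo (a : EReal) b ∧
      tp (m : ℝ) < α (z m) ∧ α (z m) ≤ tp ((m : ℝ) + 1)) → ∑ m ∈ J, tp (m * σ) * Ψ (z m) ≤ M) :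
    ∫⁻ t in erIoo (a : EReal) b, φ t * α t ^ σ ≤ tp σ * M := by
  classical
  set I := erIoo (a : EReal) b with hI
  have hIc : ∀ s ∈ I, ∀ t ∈ I, ∀ z ∈ Icc s t, z ∈ I := by
    intro s hs t ht z hz
    exact ⟨hs.1.trans_le (by exact_mod_cast hz.1), lt_of_le_of_lt (by exact_mod_cast hz.2) ht.2⟩
  set Λ : ℤ → Set ℝ := fun m => {t | t ∈ I ∧ tp (m : ℝ) < α t ∧ α t ≤ tp ((m : ℝ) + 1)} with hΛ
  set Z : Set ℝ := {t | t ∈ I ∧ α t = 0} with hZ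
  have hΛm : ∀ m, MeasurableSet (Λ m) := by
    intro m
    have : OrdConnected (Λ m) := by
      constructor
      intro s hs t ht z hz
      have hzI := hIc s hs.1 t ht.1 z hz
      exact ⟨hzI, hs.2.1.trans_le (hα hs.1 hzI hz.1), (hα hzI ht.1 hz.2).trans ht.2.2⟩
    exact this.measurableSet
  have hZm : MeasurableSet Z := by
    have : OrdConnected Z := by
      constructor
      intro s hs t ht z hz
      have hzI := hIc s hs.1 t ht.1 z hz
      exact ⟨hzI, le_antisymm ((hα hzI ht.1 hz.2).trans ht.2.le) bot_le⟩
    exact this.measurableSet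
  have hsub : I ⊆ Z ∪ ⋃ m, Λ m := by
    intro t ht
    rcases eq_or_ne (α t) 0 with h | h
    · exact Or.inl ⟨ht, h⟩
    · obtain ⟨k, hk⟩ := exists_dyadic (pos_iff_ne_zero.2 h) (hfin t ht)
      exact Or.inr (mem_iUnion.2 ⟨k, ht, hk⟩)
  have hZ0 : ∫⁻ t in Z, φ t * α t ^ σ = 0 := by
    rw [setLIntegral_congr_fun (g := fun _ => 0) hZm]
    · simp
    · intro t ht
      dsimp only
      rw [ht.2, ENNReal.zero_rpow_of_pos hσ, mul_zero]
  have h1 : ∀ m : ℤ, ∫⁻ t in Λ m, φ t * α t ^ σ ≤ tp σ * (tp (m * σ) * ∫⁻ t in Λ m, φ t) := by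
    intro m
    rw [← mul_assoc, ← tp_add, ← lintegral_const_mul _ hφ]
    refine setLIntegral_mono' (hΛm m) fun t ht => ?_
    rw [mul_comm]
    refine mul_le_mul' ?_ le_rfl
    refine (ENNReal.rpow_le_rpow ht.2.2 hσ.le).trans (le_of_eq ?_)
    rw [tp_rpow]; congr 1; ring
  have h2 : ∑' m : ℤ, tp (m * σ) * ∫⁻ t in Λ m, φ t ≤ M := by
    rw [ENNReal.tsum_eq_iSup_sum]
    refine iSup_le fun J => ?_
    have h3 : ∑ m ∈ J, tp (m * σ) * ∫⁻ t in Λ m, φ t ≤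
        ∑ m ∈ J.filter (fun m => (Λ m).Nonempty), ⨆ z : Λ m, tp (m * σ) * Ψ z := by
      rw [Finset.sum_filter]
      refine Finset.sum_le_sum fun m _ => ?_
      split_ifs with h
      · rw [← ENNReal.mul_iSup]
        refine mul_le_mul' le_rfl ((lemQ (fun t ht => ht.1) φ).trans ?_)
        exact iSup_mono fun z => hΨ z z.2.1
      · rw [not_nonempty_iff_eq_empty] at h
        rw [h]; simp
    refine h3.trans ?_
    have := sum_iSup_le (J.filter (fun m => (Λ m).Nonempty)) Λ (fun m z => tp (m * σ) * Ψ z) M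
      (fun m hm => (Finset.mem_filter.1 hm).2) 0 (by
        intro z hz
        rw [zero_add]
        exact H _ z fun m hm => hz m hm)
    rwa [zero_add] at this
  calc _ ≤ _ := lintegral_mono_set hsub
    _ ≤ _ := lintegral_union_le _ _ _
    _ ≤ 0 + ∑' m : ℤ, tp σ * (tp (m * σ) * ∫⁻ t in Λ m, φ t) := by
        rw [hZ0]
        exact add_le_add le_rfl ((lintegral_iUnion_le _ _).trans (ENNReal.tsum_le_tsum h1))
    _ ≤ _ := by
        rw [zero_add, ENNReal.tsum_mul_left]
        gcongr

lemma lemP_lower {a : ℝ} {b : EReal} {u : ℝ → ℝ≥0∞} (hu : Measurable u)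
    (hfin : ∀ x ∈ erIoo (a : EReal) b, Wf u b x < ∞) {κ : ℝ} (hκ : 0 < κ) {x : ℝ}
    (hx : x ∈ erIoo (a : EReal) b) :
    Wf u b x ^ (κ + 1) ≤ tp (κ + 1) * ∫⁻ t in erIoo (x : EReal) b, Wf u b t ^ κ * u t := by
  rcases eq_or_ne (Wf u b x) 0 with h0 | h0
  · rw [h0, ENNReal.zero_rpow_of_pos (by linarith)]; exact bot_le
  have hxt := (hfin x hx).ne
  have hc : Wf u b x / 2 < Wf u b x := ENNReal.half_lt_self h0 hxt
  obtain ⟨y, hy, hyc⟩ := Wf_ivt (a := x) (b := b) (w := u)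
    (fun t ht => hfin t (erIoo_subset hx.1.le le_rfl ht)) (ENNReal.half_pos h0) hc
  have hxy : x < y := by exact_mod_cast hy.1
  have hs := Wf_split u b hxy.le hy.2
  have h2 : ∫⁻ t in Ioc x y, u t = Wf u b x / 2 := by
    have h3 : Wf u b x / 2 + Wf u b x / 2 = (∫⁻ t in Ioc x y, u t) + Wf u b x / 2 := by
      rw [ENNReal.add_halves, ← hyc]; exact hs
    exact ((ENNReal.add_left_inj (ENNReal.div_lt_top hxt (by simp)).ne).1 h3).symm
  have h3 : (Wf u b x / 2) ^ (κ + 1) ≤ ∫⁻ t in erIoo (x : EReal) b, Wf u b t ^ κ * u t := by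
    calc (Wf u b x / 2) ^ (κ + 1) = (Wf u b x / 2) ^ κ * (Wf u b x / 2) := by
          rw [ENNReal.rpow_add_of_nonneg _ _ hκ.le (by norm_num), ENNReal.rpow_one]
      _ = ∫⁻ t in Ioc x y, (Wf u b x / 2) ^ κ * u t := by
          rw [lintegral_const_mul _ hu, h2]
      _ ≤ ∫⁻ t in Ioc x y, Wf u b t ^ κ * u t := by
          refine setLIntegral_mono' measurableSet_Ioc fun t ht => ?_
          gcongr
          rw [← hyc]; exact Wf_anti u b ht.2
      _ ≤ _ := lintegral_mono_set (Ioc_subset_erIoo le_rfl hy.2)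
  refine le_trans (le_of_eq ?_) (mul_le_mul' le_rfl h3)
  rw [ENNReal.div_rpow_of_nonneg _ _ (by linarith), tp, ENNReal.mul_div_cancel]
  · exact tp_ne_zero _
  · exact tp_ne_top _

lemma lemP_upper (u : ℝ → ℝ≥0∞) (hu : Measurable u) (b : EReal) {κ : ℝ} (hκ : 0 < κ) (x : ℝ) :
    ∫⁻ t in erIoo (x : EReal) b, Wf u b t ^ κ * u t ≤ Wf u b x ^ (κ + 1) := by
  rw [ENNReal.rpow_add_of_nonneg _ _ hκ.le (by norm_num), ENNReal.rpow_one]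
  conv_rhs => rw [Wf]
  rw [← lintegral_const_mul _ hu]
  refine setLIntegral_mono' (measurableSet_erIoo _ _) fun t ht => ?_
  gcongr
  exact Wf_anti u b (by exact_mod_cast ht.1.le)

lemma lemT (p q r : ℝ) (hq : 0 < q) (hqp : q < p) (hr : 0 < r) :
    ∃ C : ℝ≥0∞, C < ∞ ∧ ∀ (a : ℝ) (b : EReal) (u v : ℝ → ℝ≥0∞), Measurable u → Measurable v →
      (∀ᵐ t ∂(volume.restrict (erIoo (a : EReal) b)), 0 < u t) →
      (∀ x ∈ erIoo (a : EReal) b, Wf u b x < ∞) →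
      ∀ (R : (ℝ → ℝ≥0∞) → ℝ≥0∞),
      (∀ (J : Finset ℤ) (c : ℤ → ℝ≥0∞) (g : ℤ → ℝ → ℝ≥0∞), (∀ j, Measurable (g j)) →
        R (fun t => ∑ j ∈ J, c j * g j t) ≤ ∑ j ∈ J, c j ^ p * R (g j)) →
      ∀ (S : ℝ≥0∞), S < ∞ →
      (∀ f, Measurable f → ∀ E : ℝ≥0∞, E < ∞ → R f ≤ E →
        ∫⁻ t in erIoo (a : EReal) b, (∫⁻ s in Ioo a t, f s ^ r * v s) ^ (q / r) * u t ≤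
          S * E ^ (q / p)) →
      ∀ (G : ℝ → ℝ≥0∞), MonotoneOn G (erIoo (a : EReal) b) →
      (∀ z ∈ erIoo (a : EReal) b, ∀ l < G z, ∃ g, Measurable g ∧ R g ≤ 1 ∧
        l ^ (r * ((p - q) / (p * q))) ≤ ∫⁻ s in Ioo a z, g s ^ r * v s) →
      ∫⁻ t in erIoo (a : EReal) b, Wf u b t ^ (q / (p - q)) * u t * G t ≤
        C * S ^ (p / (p - q)) := by
  have hp : 0 < p := by linarith
  have hpq : 0 < p - q := by linarith
  set κ := q / (p - q) with hκ
  set σ := p / (p - q) with hσ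
  have hκ0 : 0 < κ := by positivity
  have hσ0 : 0 < σ := by positivity
  have hσκ : σ = κ + 1 := by rw [hσ, hκ]; field_simp; ring
  refine ⟨tp 1 * (2 * tp (κ + 1)) ^ σ, ENNReal.mul_lt_top (tp_lt_top _)
    (ENNReal.rpow_lt_top_of_nonneg hσ0.le (ENNReal.mul_ne_top (by simp) (tp_ne_top _))), ?_⟩
  intro a b u v hu hv hup hUfin R hR S hS hLS G hG hGe
  set I := erIoo (a : EReal) b with hI
  set L : (ℝ → ℝ≥0∞) → ℝ≥0∞ := fun f =>
    ∫⁻ t in I, (∫⁻ s in Ioo a t, f s ^ r * v s) ^ (q / r) * u t with hL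
  set ε := r * ((p - q) / (p * q)) with hε
  have hε0 : 0 < ε := by positivity
  have hεe : ε * (q / r) = (p - q) / p := by rw [hε]; field_simp
  -- finiteness of G
  have hGfin : ∀ z ∈ I, G z < ∞ := by
    intro z hz
    by_contra hcon
    rw [not_lt, top_le_iff] at hcon
    have hU0 : 0 < Wf u b z := Wf_pos hu hup hz.1.le hz.2
    set l := (S / Wf u b z + 1) ^ (p / (p - q)) with hl
    have hlt : l < ∞ := ENNReal.rpow_lt_top_of_nonneg hσ0.le
      (ENNReal.add_ne_top.2 ⟨(ENNReal.div_lt_top hS.ne hU0.ne').ne, by simp⟩)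
    obtain ⟨g, hg, hRg, hge⟩ := hGe z hz l (by rw [hcon]; exact hlt)
    have h1 := hLS g hg 1 (by simp) hRg
    rw [ENNReal.one_rpow, mul_one] at h1
    have h2 : (S / Wf u b z + 1) * Wf u b z ≤ S := by
      refine le_trans ?_ h1
      conv_lhs => enter [2]; rw [Wf]
      rw [← lintegral_const_mul _ hu]
      refine le_trans (setLIntegral_mono' (measurableSet_erIoo _ _) fun t ht => ?_)
        (lintegral_mono_set (erIoo_subset hz.1.le le_rfl))
      refine mul_le_mul' ?_ le_rfl
      calc S / Wf u b z + 1 = (l ^ ε) ^ (q / r) := by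
            rw [← ENNReal.rpow_mul, hεe, hl, ← ENNReal.rpow_mul]
            have : p / (p - q) * ((p - q) / p) = 1 := by field_simp
            rw [this, ENNReal.rpow_one]
        _ ≤ _ := by
            refine ENNReal.rpow_le_rpow (hge.trans (lintegral_mono_set
              (Ioo_subset_Ioo le_rfl ?_))) (by positivity)
            exact_mod_cast ht.1.le
    rw [add_mul, one_mul, ENNReal.div_mul_cancel hU0.ne' (hUfin z hz).ne] at h2
    exact absurd h2 (not_le.2 (ENNReal.lt_add_right hS.ne hU0.ne'))
  have hUm := Wf_meas u b
  have hφ : Measurable fun t => Wf u b t ^ κ * u t := (hUm.pow_const _).mul hu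
  have hlay := layers (a := a) (b := b) (α := G) (φ := fun t => Wf u b t ^ κ * u t)
    (Ψ := fun z => Wf u b z ^ σ) hG hGfin (σ := 1) one_pos hφ
    (fun z _ => by rw [hσκ]; exact lemP_upper u hu b hκ0 z)
    (M := (2 * tp (κ + 1) * S) ^ σ) ?_
  · simp only [ENNReal.rpow_one] at hlay
    refine hlay.trans (le_of_eq ?_)
    rw [ENNReal.mul_rpow_of_nonneg _ _ hσ0.le, mul_assoc]
  intro J z hz
  simp only [mul_one]
  set E := ∑ m ∈ J, tp (m : ℝ) * Wf u b (z m) ^ σ with hE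
  have hEt : E < ∞ := by
    refine ENNReal.sum_lt_top.2 fun m hm => ENNReal.mul_lt_top (tp_lt_top _)
      (ENNReal.rpow_lt_top_of_nonneg hσ0.le (hUfin _ (hz m hm).1).ne)
  have hex : ∀ m : ℤ, ∃ g, Measurable g ∧ (m ∈ J → R g ≤ 1 ∧
      tp (m : ℝ) ^ ε ≤ ∫⁻ s in Ioo a (z m), g s ^ r * v s) := by
    intro m
    by_cases hm : m ∈ J
    · obtain ⟨g, h1, h2, h3⟩ := hGe (z m) (hz m hm).1 _ (hz m hm).2.1
      exact ⟨g, h1, fun _ => ⟨h2, h3⟩⟩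
    · exact ⟨fun _ => 0, measurable_const, fun h => absurd h hm⟩
  choose g hgm hg using hex
  set c : ℤ → ℝ≥0∞ := fun m => tp (m / p) * Wf u b (z m) ^ (σ / p) with hc
  set f : ℝ → ℝ≥0∞ := fun t => ∑ j ∈ J, c j * g j t with hf
  have hfm : Measurable f := Finset.measurable_sum _ fun j _ => (hgm j).const_mul _
  have hcp : ∀ m, c m ^ p = tp (m : ℝ) * Wf u b (z m) ^ σ := by
    intro m
    rw [hc]; simp only
    rw [ENNReal.mul_rpow_of_nonneg _ _ hp.le, tp_rpow, ← ENNReal.rpow_mul,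
      div_mul_cancel₀ _ hp.ne', div_mul_cancel₀ _ hp.ne']
  have hRf : R f ≤ E := by
    refine (hR J c g hgm).trans (Finset.sum_le_sum fun m hm => ?_)
    rw [hcp]
    calc _ ≤ tp (m : ℝ) * Wf u b (z m) ^ σ * 1 := by gcongr; exact (hg m hm).1
      _ = _ := mul_one _
  have hLf : L f ≤ S * E ^ (q / p) := hLS f hfm E hEt hRf
  have hpt : ∀ m ∈ J, ∀ t, z m < t →
      tp (m : ℝ) * Wf u b t ^ κ ≤ (∫⁻ s in Ioo a t, f s ^ r * v s) ^ (q / r) := by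
    intro m hm t ht
    have h1 : c m ^ r * tp (m : ℝ) ^ ε ≤ ∫⁻ s in Ioo a t, f s ^ r * v s := by
      calc _ ≤ c m ^ r * ∫⁻ s in Ioo a (z m), g m s ^ r * v s := by gcongr; exact (hg m hm).2
        _ = ∫⁻ s in Ioo a (z m), c m ^ r * (g m s ^ r * v s) :=
            (lintegral_const_mul _ (((hgm m).pow_const _).mul hv)).symm
        _ ≤ ∫⁻ s in Ioo a (z m), f s ^ r * v s := by
            refine lintegral_mono fun s => ?_
            rw [← mul_assoc, ← ENNReal.mul_rpow_of_nonneg _ _ hr.le]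
            gcongr
            exact Finset.single_le_sum (f := fun j => c j * g j s) (fun _ _ => bot_le) hm
        _ ≤ _ := lintegral_mono_set (Ioo_subset_Ioo le_rfl ht.le)
    refine le_trans ?_ (ENNReal.rpow_le_rpow h1 (show 0 ≤ q / r by positivity))
    rw [ENNReal.mul_rpow_of_nonneg _ _ (by positivity), ← ENNReal.rpow_mul, ← ENNReal.rpow_mul, hεe,
      tp_rpow, hc]
    simp only
    rw [ENNReal.mul_rpow_of_nonneg _ _ (by positivity), tp_rpow, ← ENNReal.rpow_mul, mul_right_comm,
      ← tp_add]
    have e1 : (m : ℝ) / p * (r * (q / r)) + m * ((p - q) / p) = m := by field_simp; ring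
    have e2 : σ / p * (r * (q / r)) = κ := by rw [hσ, hκ]; field_simp
    rw [e1, e2]
    gcongr
    exact Wf_anti u b ht.le
  have hlow : ∑ m ∈ J, tp (m : ℝ) * ∫⁻ t in erIoo (z m : EReal) b, Wf u b t ^ κ * u t ≤ 2 * L f := by
    have h1 : ∀ m ∈ J, tp (m : ℝ) * ∫⁻ t in erIoo (z m : EReal) b, Wf u b t ^ κ * u t =
        ∫⁻ t in I, tp (m : ℝ) * (erIoo (z m : EReal) b).indicator (fun t => Wf u b t ^ κ * u t) t := by
      intro m hm
      rw [lintegral_const_mul _ (hφ.indicator (measurableSet_erIoo _ _)),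
        setLIntegral_indicator (measurableSet_erIoo _ _)]
      congr 3
      exact (inter_eq_left.2 (erIoo_subset (hz m hm).1.1.le le_rfl)).symm
    rw [Finset.sum_congr rfl h1, ← lintegral_finsetSum _ fun m _ =>
      (hφ.indicator (measurableSet_erIoo _ _)).const_mul _, hL]
    simp only
    rw [← lintegral_const_mul' _ _ (by simp)]
    refine setLIntegral_mono' (measurableSet_erIoo _ _) fun t ht => ?_
    classical
    set K := J.filter fun m => z m < t with hK
    have h2 : ∑ m ∈ J, tp (m : ℝ) * (erIoo (z m : EReal) b).indicator
        (fun t => Wf u b t ^ κ * u t) t = (∑ m ∈ K, tp (m : ℝ)) * (Wf u b t ^ κ * u t) := by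
      rw [Finset.sum_mul, hK, Finset.sum_filter]
      refine Finset.sum_congr rfl fun m _ => ?_
      split_ifs with h
      · rw [indicator_of_mem]
        exact ⟨by exact_mod_cast h, ht.2⟩
      · rw [indicator_of_notMem, mul_zero]
        intro h'
        exact h (by exact_mod_cast h'.1)
    rw [h2]
    rcases K.eq_empty_or_nonempty with h | h
    · rw [h]; simp
    · have h3 := hpt (K.max' h) (Finset.mem_filter.1 (K.max'_mem h)).1 t
        (Finset.mem_filter.1 (K.max'_mem h)).2
      calc _ ≤ (2 * tp ((K.max' h : ℤ) : ℝ)) * (Wf u b t ^ κ * u t) := by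
            gcongr; exact geo_finset K h
        _ = 2 * ((tp ((K.max' h : ℤ) : ℝ) * Wf u b t ^ κ) * u t) := by ring
        _ ≤ _ := by gcongr
  have hEle : E ≤ 2 * tp (κ + 1) * S * E ^ (q / p) := by
    calc E ≤ ∑ m ∈ J, tp (m : ℝ) * (tp (κ + 1) *
            ∫⁻ t in erIoo (z m : EReal) b, Wf u b t ^ κ * u t) := by
          refine Finset.sum_le_sum fun m hm => ?_
          gcongr
          rw [hσκ]
          exact lemP_lower hu hUfin hκ0 (hz m hm).1
      _ = tp (κ + 1) * ∑ m ∈ J, tp (m : ℝ) *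
            ∫⁻ t in erIoo (z m : EReal) b, Wf u b t ^ κ * u t := by
          rw [Finset.mul_sum]
          exact Finset.sum_congr rfl fun m _ => by ring
      _ ≤ tp (κ + 1) * (2 * (S * E ^ (q / p))) := by gcongr; exact hlow.trans (by gcongr)
      _ = _ := by ring
  have := self_improve (by positivity) (by rw [div_lt_one hp]; exact hqp) hEt hEle
  have e : 1 / (1 - q / p) = σ := by rw [hσ]; field_simp
  rwa [e] at this

noncomputable def Rf (p a : ℝ) (b : EReal) (w f : ℝ → ℝ≥0∞) : ℝ≥0∞ :=
  ∫⁻ t in erIoo (a : EReal) b, (∫⁻ s in Set.Ioo a t, f s) ^ p * w t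

noncomputable def Lf (q r a : ℝ) (b : EReal) (u v f : ℝ → ℝ≥0∞) : ℝ≥0∞ :=
  ∫⁻ t in erIoo (a : EReal) b, (∫⁻ s in Ioo a t, f s ^ r * v s) ^ (q / r) * u t

/-- local best constant -/
noncomputable def bet (q r : ℝ) (u v : ℝ → ℝ≥0∞) (y x : ℝ) : ℝ≥0∞ :=
  ⨆ h : {h : ℝ → ℝ≥0∞ // Measurable h ∧ ∫⁻ t, h t ≤ 1},
    ∫⁻ t in Ioo y x, (∫⁻ s in Ioo y t, h.1 s ^ r * v s) ^ (q / r) * u t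

lemma inner_meas (a γ : ℝ) (φ : ℝ → ℝ≥0∞) {w : ℝ → ℝ≥0∞} (hw : Measurable w) :
    Measurable fun t => (∫⁻ s in Ioo a t, φ s) ^ γ * w t := by
  have : Monotone fun t => ∫⁻ s in Ioo a t, φ s := fun s t hst =>
        lintegral_mono_set (Ioo_subset_Ioo le_rfl hst)
  exact (this.measurable.pow_const _).mul hw

lemma Rf_sum {p a : ℝ} {b : EReal} {w : ℝ → ℝ≥0∞} (hp : 0 < p) (hp1 : p ≤ 1) (hw : Measurable w)
    (J : Finset ℤ) (c : ℤ → ℝ≥0∞) (g : ℤ → ℝ → ℝ≥0∞) (hg : ∀ j, Measurable (g j)) :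
    Rf p a b w (fun t => ∑ j ∈ J, c j * g j t) ≤ ∑ j ∈ J, c j ^ p * Rf p a b w (g j) := by
  have h1 : ∀ j, c j ^ p * Rf p a b w (g j) = ∫⁻ t in erIoo (a : EReal) b,
      c j ^ p * ((∫⁻ s in Set.Ioo a t, g j s) ^ p * w t) := fun j =>
    (lintegral_const_mul _ (inner_meas a p _ hw)).symm
  simp only [h1]
  rw [← lintegral_finsetSum _ fun j _ => (inner_meas a p _ hw).const_mul _]
  refine lintegral_mono fun t => ?_
  dsimp only
  rw [lintegral_finsetSum _ fun j _ => (hg j).const_mul _]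
  simp only [← mul_assoc]
  rw [← Finset.sum_mul]
  gcongr
  refine (finset_rpow_le J p hp hp1 _).trans (le_of_eq (Finset.sum_congr rfl fun j _ => ?_))
  rw [lintegral_const_mul _ (hg j), ENNReal.mul_rpow_of_nonneg _ _ hp.le]

lemma Rf_le {p a : ℝ} {b : EReal} {w : ℝ → ℝ≥0∞} (hp : 0 < p) {h : ℝ → ℝ≥0∞}
    (h1 : ∫⁻ t, h t ≤ 1) {y : ℝ} (hy : y ∈ erIoo (a : EReal) b)
    (h0 : ∀ t ≤ y, h t = 0) : Rf p a b w h ≤ Wf w b y := by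
  have hsub : erIoo (a : EReal) b ⊆ Iic y ∪ erIoo (y : EReal) b := by
    intro t ht
    rcases le_or_gt t y with h | h
    · exact Or.inl h
    · exact Or.inr ⟨by exact_mod_cast h, ht.2⟩
  unfold Rf
  refine (lintegral_mono_set hsub).trans ((lintegral_union_le _ _ _).trans ?_)
  have e : ∫⁻ t in Iic y, (∫⁻ s in Set.Ioo a t, h s) ^ p * w t = 0 := by
    rw [setLIntegral_congr_fun (g := fun _ => 0) measurableSet_Iic]
    · simp
    · intro t ht
      dsimp only
      rw [setLIntegral_congr_fun (g := fun _ => 0) measurableSet_Ioo]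
      · simp [ENNReal.zero_rpow_of_pos hp]
      · intro s hs
        exact h0 s (hs.2.le.trans ht)
  rw [e, zero_add]
  unfold Wf
  refine setLIntegral_mono' (measurableSet_erIoo _ _) fun t _ => ?_
  calc _ ≤ 1 ^ p * w t := by
        gcongr
        exact (setLIntegral_le_lintegral _ _).trans h1
    _ = _ := by simp

lemma Rf_const {p a : ℝ} {b : EReal} {w : ℝ → ℝ≥0∞} (hp : 0 < p) (hw : Measurable w)
    (c : ℝ≥0∞) {g : ℝ → ℝ≥0∞} (hg : Measurable g) :
    Rf p a b w (fun t => c * g t) = c ^ p * Rf p a b w g := by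
  unfold Rf
  rw [← lintegral_const_mul _ (inner_meas a p _ hw)]
  refine lintegral_congr fun t => ?_
  rw [lintegral_const_mul _ hg, ENNReal.mul_rpow_of_nonneg _ _ hp.le, mul_assoc]

/-- finiteness of the tail of `u` -/
lemma U_fin {p q r a : ℝ} {b : EReal} {u v w : ℝ → ℝ≥0∞} (hp : 0 < p) (hq : 0 < q)
    (hr : 0 < r) (hr1 : r ≤ 1) (hu : Measurable u) (hv : Measurable v)
    (hvp : ∀ᵐ t ∂(volume.restrict (erIoo (a : EReal) b)), 0 < v t ∧ v t < ∞)
    (hW : ∀ x : ℝ, x ∈ erIoo (a : EReal) b → 0 < Wf w b x ∧ Wf w b x < ∞)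
    {S : ℝ≥0∞} (hS : S < ∞)
    (H : ∀ f, Measurable f → ∀ E : ℝ≥0∞, E < ∞ → Rf p a b w f ≤ E →
      Lf q r a b u v f ≤ S * E ^ (q / p)) :
    ∀ x ∈ erIoo (a : EReal) b, Wf u b x < ∞ := by
  intro x hx
  have hax : a < x := by exact_mod_cast hx.1
  obtain ⟨y, hay, hyx⟩ := exists_between hax
  have hyI : y ∈ erIoo (a : EReal) b :=
    ⟨by exact_mod_cast hay, lt_trans (by exact_mod_cast hyx) hx.2⟩
  have hV := Vr_pos hr hr1 hv (hvp.mono fun t ht => ht.1) hyx hyI.1.le hx.2.le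
  obtain ⟨c, hc0, hcV⟩ := exists_between hV
  obtain ⟨h, hm, hle, hoff, hge⟩ := Vr_ext hr hr1 hv (hvp.mono fun t ht => ht.2) hyI.1.le hx.2.le hcV
  have hR : Rf p a b w h ≤ Wf w b y :=
    Rf_le hp hle hyI fun t ht => hoff t fun h => absurd h.1 (not_lt.2 ht)
  have h1 := H h hm _ (hW y hyI).2 hR
  have h2 : c ^ q * Wf u b x ≤ Lf q r a b u v h := by
    unfold Lf
    conv_lhs => enter [2]; rw [Wf]
    rw [← lintegral_const_mul _ hu]
    refine le_trans (setLIntegral_mono' (measurableSet_erIoo _ _) fun t ht => ?_)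
      (lintegral_mono_set (erIoo_subset hx.1.le le_rfl))
    gcongr
    have e : c ^ q = (c ^ r) ^ (q / r) := by
      rw [← ENNReal.rpow_mul]; congr 1; field_simp
    rw [e]
    refine ENNReal.rpow_le_rpow (hge.trans (lintegral_mono_set (Ioo_subset_Ioo hay.le ?_)))
      (by positivity)
    exact_mod_cast ht.1.le
  have h3 : c ^ q * Wf u b x < ∞ := (h2.trans h1).trans_lt
    (ENNReal.mul_lt_top hS (ENNReal.rpow_lt_top_of_nonneg (by positivity) (hW y hyI).2.ne))
  by_contra hcon
  rw [not_lt, top_le_iff] at hcon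
  rw [hcon, ENNReal.mul_top] at h3
  · exact absurd h3 (by simp)
  · intro h0
    rw [ENNReal.rpow_eq_zero_iff_of_pos hq] at h0
    exact hc0.ne' h0

lemma C4_lower (p q r : ℝ) (hq : 0 < q) (hqp : q < p) (hpr : p ≤ r) (hr1 : r ≤ 1) :
    ∃ C : ℝ≥0∞, C < ∞ ∧ ∀ (a : ℝ) (b : EReal) (u v w : ℝ → ℝ≥0∞), Measurable u → Measurable v →
      Measurable w →
      (∀ᵐ t ∂(volume.restrict (erIoo (a : EReal) b)), 0 < u t ∧ u t < ∞) →
      (∀ᵐ t ∂(volume.restrict (erIoo (a : EReal) b)), 0 < v t ∧ v t < ∞) →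
      (∀ x : ℝ, x ∈ erIoo (a : EReal) b → 0 < Wf w b x ∧ Wf w b x < ∞) →
      ∀ S : ℝ≥0∞, S < ∞ →
      (∀ f, Measurable f → ∀ E : ℝ≥0∞, E < ∞ → Rf p a b w f ≤ E →
        Lf q r a b u v f ≤ S * E ^ (q / p)) →
      ∫⁻ x in erIoo (a : EReal) b, Wf u b x ^ (q / (p - q)) * u x * G4 p q r a b v w x ≤
        C * S ^ (p / (p - q)) := by
  have hp : 0 < p := by linarith
  have hr : 0 < r := by linarith
  have hpq : 0 < p - q := by linarith
  obtain ⟨C, hC, HT⟩ := lemT p q r hq hqp hr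
  refine ⟨C, hC, ?_⟩
  intro a b u v w hu hv hw hup hvp hW S hS H
  refine HT a b u v hu hv (hup.mono fun t ht => ht.1) (U_fin hp hq hr hr1 hu hv hvp hW hS H)
    (Rf p a b w) (fun J c g hg => Rf_sum hp (by linarith) hw J c g hg) S hS H
    (G4 p q r a b v w) ((G4_mono hr hr1 hq hqp v w).monotoneOn _) ?_
  intro z hz l hl
  obtain ⟨t, ht, hlt⟩ := essSup_exists hl
  have htI : t ∈ erIoo (a : EReal) b :=
    ⟨by exact_mod_cast ht.1, lt_trans (by exact_mod_cast ht.2) hz.2⟩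
  obtain ⟨hW0, hWt⟩ := hW t htI
  set W := Wf w b t with hWdef
  set κ := q / (p - q) with hκ
  set ρ := p * q / (p - q) with hρ
  have hκ0 : 0 < κ := by positivity
  have hρ0 : 0 < ρ := by positivity
  have hκt : W ^ κ ≠ ∞ := ENNReal.rpow_ne_top_of_nonneg hκ0.le hWt.ne
  have hκz : W ^ κ ≠ 0 := (ENNReal.rpow_pos hW0 hWt.ne).ne'
  set c := l ^ (1 / ρ) * W ^ (1 / p) with hc
  have hcV : c < Vr r v t (z : EReal) := by
    have h1 : l * W ^ κ < Vr r v t (z : EReal) ^ ρ := by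
      have : l * W ^ κ < (W ^ (-κ) * Vr r v t (z : EReal) ^ ρ) * W ^ κ :=
        (ENNReal.mul_lt_mul_iff_left hκz hκt).2 hlt
      rwa [mul_right_comm, ENNReal.rpow_neg, ENNReal.inv_mul_cancel hκz hκt, one_mul] at this
    have h2 := ENNReal.rpow_lt_rpow h1 (show 0 < 1 / ρ by positivity)
    rw [ENNReal.mul_rpow_of_nonneg _ _ (by positivity), ← ENNReal.rpow_mul, ← ENNReal.rpow_mul] at h2
    have e1 : κ * (1 / ρ) = 1 / p := by rw [hκ, hρ]; field_simp
    have e2 : ρ * (1 / ρ) = 1 := by field_simp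
    rwa [e1, e2, ENNReal.rpow_one] at h2
  obtain ⟨h, hm, hle, hoff, hge⟩ := Vr_ext hr hr1 hv (hvp.mono fun t ht => ht.2) htI.1.le hz.2.le hcV
  have hR : Rf p a b w h ≤ W :=
    Rf_le hp hle htI fun s hs => hoff s fun h => absurd h.1 (not_lt.2 hs)
  refine ⟨fun s => W ^ (-(1 / p)) * h s, hm.const_mul _, ?_, ?_⟩
  · rw [Rf_const hp hw _ hm, ← ENNReal.rpow_mul]
    have e1 : -(1 / p) * p = -1 := by field_simp
    rw [e1, ENNReal.rpow_neg_one]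
    exact (mul_le_mul' le_rfl hR).trans (le_of_eq (ENNReal.inv_mul_cancel hW0.ne' hWt.ne))
  · calc l ^ (r * ((p - q) / (p * q))) = (W ^ (-(1 / p))) ^ r * c ^ r := by
          rw [← ENNReal.mul_rpow_of_nonneg _ _ hr.le, hc, mul_left_comm,
            ← ENNReal.rpow_add _ _ hW0.ne' hWt.ne, neg_add_cancel, ENNReal.rpow_zero, mul_one,
            ← ENNReal.rpow_mul]
          congr 1
          rw [hρ]; field_simp
      _ ≤ (W ^ (-(1 / p))) ^ r * ∫⁻ s in Ioo t z, h s ^ r * v s := by gcongr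
      _ = ∫⁻ s in Ioo t z, (W ^ (-(1 / p))) ^ r * (h s ^ r * v s) :=
          (lintegral_const_mul _ ((hm.pow_const _).mul hv)).symm
      _ = ∫⁻ s in Ioo t z, (W ^ (-(1 / p)) * h s) ^ r * v s := by
          refine lintegral_congr fun s => ?_
          rw [ENNReal.mul_rpow_of_nonneg _ _ hr.le, mul_assoc]
      _ ≤ _ := lintegral_mono_set (Ioo_subset_Ioo ht.1.le le_rfl)

lemma bet_scale {q r : ℝ} (hq : 0 < q) (hr : 0 < r) {u v : ℝ → ℝ≥0∞}
    (hu : Measurable u) (hv : Measurable v) {y x : ℝ} {f : ℝ → ℝ≥0∞} (hf : Measurable f)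
    {E : ℝ≥0∞} (hE : E < ∞) (h : ∫⁻ t, f t ≤ E) :
    ∫⁻ t in Ioo y x, (∫⁻ s in Ioo y t, f s ^ r * v s) ^ (q / r) * u t ≤
      bet q r u v y x * E ^ q := by
  have hqr : 0 < q / r := by positivity
  rcases eq_or_ne E 0 with h0 | h0
  · have hf0 : f =ᵐ[volume] 0 := (lintegral_eq_zero_iff hf).1 (le_antisymm (h0 ▸ h) bot_le)
    have hin : ∀ t, ∫⁻ s in Ioo y t, f s ^ r * v s = 0 := by
      intro t
      rw [lintegral_congr_ae (g := fun _ => 0)]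
      · simp
      · filter_upwards [ae_restrict_of_ae hf0] with s hs
        simp only [Pi.zero_apply] at hs
        simp [hs, ENNReal.zero_rpow_of_pos hr]
    simp [hin, ENNReal.zero_rpow_of_pos hqr]
  · have hfac : ∀ t, (∫⁻ s in Ioo y t, f s ^ r * v s) ^ (q / r) * u t =
        E ^ q * ((∫⁻ s in Ioo y t, (E⁻¹ * f s) ^ r * v s) ^ (q / r) * u t) := by
      intro t
      have e1 : ∫⁻ s in Ioo y t, f s ^ r * v s =
          E ^ r * ∫⁻ s in Ioo y t, (E⁻¹ * f s) ^ r * v s := by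
        refine Eq.trans (lintegral_congr fun s => ?_)
          (lintegral_const_mul _ (((hf.const_mul _).pow_const _).mul hv))
        rw [← mul_assoc, ← ENNReal.mul_rpow_of_nonneg _ _ hr.le, ← mul_assoc,
          ENNReal.mul_inv_cancel h0 hE.ne, one_mul]
      rw [e1, ENNReal.mul_rpow_of_nonneg _ _ hqr.le, ← ENNReal.rpow_mul, mul_assoc]
      congr 2
      field_simp
    simp only [hfac]
    rw [lintegral_const_mul _ (inner_meas y (q / r) _ hu), mul_comm]
    gcongr
    have hle : ∫⁻ t, E⁻¹ * f t ≤ 1 := by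
      rw [lintegral_const_mul _ hf]
      exact (mul_le_mul' le_rfl h).trans (le_of_eq (ENNReal.inv_mul_cancel h0 hE.ne))
    exact le_iSup (fun h : {h : ℝ → ℝ≥0∞ // Measurable h ∧ ∫⁻ t, h t ≤ 1} =>
      ∫⁻ t in Ioo y x, (∫⁻ s in Ioo y t, h.1 s ^ r * v s) ^ (q / r) * u t)
      ⟨fun t => E⁻¹ * f t, hf.const_mul _, hle⟩

/-- local lower bound -/
lemma Bf_le_bet (q r : ℝ) (hq : 0 < q) (hq1 : q < 1) (hr : 0 < r) (hr1 : r ≤ 1) :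
    ∃ C : ℝ≥0∞, C < ∞ ∧ ∀ (u v : ℝ → ℝ≥0∞), Measurable u → Measurable v → ∀ y x : ℝ,
      (∀ᵐ t ∂(volume.restrict (Ioo y x)), 0 < u t) →
      (∀ᵐ t ∂(volume.restrict (Ioo y x)), v t < ∞) →
      (∀ t ∈ Ioo y x, ∫⁻ s in Ioo t x, u s < ∞) → bet q r u v y x < ∞ →
      Bf q r u v y x ≤ C * bet q r u v y x ^ (1 / (1 - q)) := by
  have h1q : 0 < 1 - q := by linarith
  obtain ⟨C, hC, HT⟩ := lemT 1 q r hq hq1 hr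
  refine ⟨C, hC, ?_⟩
  intro u v hu hv y x hup hvf hU hb
  have h := HT y (x : EReal) u v hu hv (by rwa [erIoo_coe])
    (by intro t ht; rw [erIoo_coe] at ht; rw [Wf, erIoo_coe]; exact hU t ht)
    (fun f => ∫⁻ t, f t) (by
      intro J c g hg
      rw [lintegral_finsetSum _ fun j _ => (hg j).const_mul _]
      refine le_of_eq (Finset.sum_congr rfl fun j _ => ?_)
      rw [lintegral_const_mul _ (hg j), ENNReal.rpow_one]) (bet q r u v y x) hb (by
      intro f hf E hE hfE
      rw [erIoo_coe, div_one]
      exact bet_scale hq hr hu hv hf hE hfE)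
    (fun t => Vr r v y (t : EReal) ^ (q / (1 - q))) (by
      intro s _ t _ hst
      dsimp only
      refine ENNReal.rpow_le_rpow (Vr_mono hr hr1 v le_rfl (by exact_mod_cast hst)) (by positivity))
    (by
      intro z hz l hl
      rw [erIoo_coe] at hz
      have hcV : l ^ ((1 - q) / q) < Vr r v y (z : EReal) := by
        have h2 := ENNReal.rpow_lt_rpow hl (show 0 < (1 - q) / q by positivity)
        rw [← ENNReal.rpow_mul] at h2
        have e2 : q / (1 - q) * ((1 - q) / q) = 1 := by field_simp
        rwa [e2, ENNReal.rpow_one] at h2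
      obtain ⟨h, hm, hle, hoff, hge⟩ := Vr_ext (a := (y : EReal)) (b := (x : EReal)) hr hr1 hv
        (by rwa [erIoo_coe]) le_rfl (by exact_mod_cast hz.2.le) hcV
      refine ⟨h, hm, hle, le_trans (le_of_eq ?_) hge⟩
      rw [← ENNReal.rpow_mul]
      congr 1
      ring)
  rw [erIoo_coe] at h
  refine le_trans (le_of_eq ?_) h
  unfold Bf
  refine lintegral_congr fun t => ?_
  rw [Wf, erIoo_coe]

/-- test function supported to the right of `y` -/
lemma bet_test {p q r a : ℝ} {b : EReal} {u v w : ℝ → ℝ≥0∞} (hp : 0 < p) (hq : 0 < q) (hr : 0 < r)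
    (hW : ∀ x : ℝ, x ∈ erIoo (a : EReal) b → 0 < Wf w b x ∧ Wf w b x < ∞)
    {S : ℝ≥0∞}
    (H : ∀ f, Measurable f → ∀ E : ℝ≥0∞, E < ∞ → Rf p a b w f ≤ E →
      Lf q r a b u v f ≤ S * E ^ (q / p)) {y x : ℝ} (hy : y ∈ erIoo (a : EReal) b)
    (hx : (x : EReal) ≤ b) : bet q r u v y x ≤ S * Wf w b y ^ (q / p) := by
  unfold bet
  refine iSup_le fun h => ?_
  have hm : Measurable (indicator (Ioi y) h.1) := h.2.1.indicator measurableSet_Ioi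
  have hR : Rf p a b w (indicator (Ioi y) h.1) ≤ Wf w b y := by
    refine Rf_le hp ?_ hy ?_
    · exact (lintegral_mono fun t => indicator_le_self _ _ _).trans h.2.2
    · intro t ht
      exact indicator_of_notMem (by simpa using ht) _
  refine le_trans ?_ (H _ hm _ (hW y hy).2 hR)
  unfold Lf
  refine le_trans (setLIntegral_mono' measurableSet_Ioo fun t ht => ?_)
    (lintegral_mono_set (Ioo_subset_erIoo hy.1.le hx))
  refine mul_le_mul' (ENNReal.rpow_le_rpow ?_ (by positivity)) le_rfl
  refine le_trans (setLIntegral_mono' measurableSet_Ioo fun s hs => ?_)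
    (lintegral_mono_set (Ioo_subset_Ioo (by exact_mod_cast hy.1.le) le_rfl))
  rw [indicator_of_mem (show s ∈ Ioi y from hs.1)]

noncomputable def alp (q r a : ℝ) (b : EReal) (u v w : ℝ → ℝ≥0∞) (x : ℝ) : ℝ≥0∞ :=
  ⨆ y ∈ Ioo a x, (Wf w b y)⁻¹ * bet q r u v y x

lemma sep_bound {p q r a : ℝ} {b : EReal} {u v w : ℝ → ℝ≥0∞} (hq : 0 < q) (hqp : q < p)
    (hr : 0 < r) (hp1 : p ≤ 1) (hu : Measurable u) (hv : Measurable v) (hw : Measurable w)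
    (hW : ∀ x : ℝ, x ∈ erIoo (a : EReal) b → 0 < Wf w b x ∧ Wf w b x < ∞)
    {S : ℝ≥0∞}
    (H : ∀ f, Measurable f → ∀ E : ℝ≥0∞, E < ∞ → Rf p a b w f ≤ E →
      Lf q r a b u v f ≤ S * E ^ (q / p)) (J : Finset ℤ) (z : ℤ → ℝ)
    (hsep : ∀ m ∈ J, ∀ m' ∈ J, m' < m → m' + 2 ≤ m)
    (hz : ∀ m ∈ J, z m ∈ erIoo (a : EReal) b ∧ tp m < alp q r a b u v w (z m) ∧
      alp q r a b u v w (z m) ≤ tp (m + 1)) :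
    ∑ m ∈ J, tp (m * (p / (p - q))) * Wf w b (z m) ≤ (tp 1 * S) ^ (p / (p - q)) := by
  have hp : 0 < p := by linarith
  have hpq : 0 < p - q := by linarith
  have hqr : 0 < q / r := by positivity
  set σ := p / (p - q) with hσ
  have hch : ∀ m : ℤ, ∃ (y : ℝ) (h : ℝ → ℝ≥0∞), Measurable h ∧ (m ∈ J → y ∈ Ioo a (z m) ∧
      ∫⁻ t, h t ≤ 1 ∧ tp m * Wf w b y ≤
        ∫⁻ t in Ioo y (z m), (∫⁻ s in Ioo y t, h s ^ r * v s) ^ (q / r) * u t) := by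
    intro m
    by_cases hm : m ∈ J
    · obtain ⟨hzI, hz1, -⟩ := hz m hm
      unfold alp at hz1
      simp only [lt_iSup_iff] at hz1
      obtain ⟨y, hy, hlt⟩ := hz1
      have hyI : y ∈ erIoo (a : EReal) b :=
        ⟨by exact_mod_cast hy.1, lt_trans (by exact_mod_cast hy.2) hzI.2⟩
      obtain ⟨hW0, hWt⟩ := hW y hyI
      have h1 : tp m * Wf w b y < bet q r u v y (z m) := by
        have := (ENNReal.mul_lt_mul_iff_left hW0.ne' hWt.ne).2 hlt
        rwa [mul_right_comm, ENNReal.inv_mul_cancel hW0.ne' hWt.ne, one_mul] at this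
      unfold bet at h1
      obtain ⟨h, hh⟩ := lt_iSup_iff.1 h1
      exact ⟨y, h.1, h.2.1, fun _ => ⟨hy, h.2.2, hh.le⟩⟩
    · exact ⟨0, 0, measurable_zero, fun h => absurd h hm⟩
  choose y h hm hP using hch
  have hyI : ∀ m ∈ J, y m ∈ erIoo (a : EReal) b := fun m hmJ =>
    ⟨by exact_mod_cast (hP m hmJ).1.1, lt_trans (by exact_mod_cast (hP m hmJ).1.2) (hz m hmJ).1.2⟩
  set c : ℤ → ℝ≥0∞ := fun m => tp (m * σ / p) with hc
  set g : ℤ → ℝ → ℝ≥0∞ := fun m => indicator (Ioi (y m)) (h m) with hg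
  have hgm : ∀ m, Measurable (g m) := fun m => (hm m).indicator measurableSet_Ioi
  set f : ℝ → ℝ≥0∞ := fun t => ∑ m ∈ J, c m * g m t with hf
  have hfm : Measurable f := Finset.measurable_sum _ fun m _ => (hgm m).const_mul _
  set E := ∑ m ∈ J, tp (m * σ) * Wf w b (y m) with hE
  have hEt : E < ∞ := by
    rw [hE, ENNReal.sum_lt_top]
    exact fun m hmJ => ENNReal.mul_lt_top (tp_lt_top _) (hW _ (hyI m hmJ)).2
  have hR : Rf p a b w f ≤ E := by
    refine (Rf_sum hp hp1 hw J c g hgm).trans (Finset.sum_le_sum fun m hmJ => ?_)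
    have e : c m ^ p = tp (m * σ) := by
      rw [hc, tp_rpow]; congr 1; field_simp
    rw [e]
    gcongr
    refine Rf_le hp ?_ (hyI m hmJ) ?_
    · exact (lintegral_mono fun t => indicator_le_self _ _ _).trans (hP m hmJ).2.1
    · intro t ht
      exact indicator_of_notMem (by simpa using ht) _
  have hL := H f hfm E hEt hR
  set T : ℤ → Set ℝ := fun m => Ioo (y m) (z m) ∩ ⋂ m' ∈ J.filter (· < m), Ici (z m') with hT
  have hTm : ∀ m, MeasurableSet (T m) := fun m =>
    measurableSet_Ioo.inter (Finset.measurableSet_biInter _ fun m' _ => measurableSet_Ici)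
  have hTd' : ∀ m ∈ J, ∀ m' ∈ J, m < m' → Disjoint (T m) (T m') := by
    intro m hmJ m' hmJ' hlt
    rw [Set.disjoint_left]
    intro t ht ht'
    have h1 : z m ≤ t := by
      have := ht'.2
      simp only [mem_iInter, mem_Ici] at this
      exact this m (Finset.mem_filter.2 ⟨hmJ, hlt⟩)
    exact absurd ht.1.2 (not_lt.2 h1)
  have hTd : (J : Set ℤ).PairwiseDisjoint T := by
    intro m hmJ m' hmJ' hne
    rcases lt_or_gt_of_ne hne with h1 | h1
    · exact hTd' m hmJ m' hmJ' h1
    · exact (hTd' m' hmJ' m hmJ h1).symm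
  have hlow : ∑ m ∈ J, ∫⁻ t in T m, (∫⁻ s in Ioo a t, f s ^ r * v s) ^ (q / r) * u t ≤
      Lf q r a b u v f := by
    rw [← lintegral_biUnion_finset hTd fun m _ => hTm m]
    refine lintegral_mono_set (iUnion₂_subset fun m hmJ => ?_)
    exact inter_subset_left.trans (Ioo_subset_erIoo (hyI m hmJ).1.le (hz m hmJ).1.2.le)
  have hterm : ∀ m ∈ J, tp (-1) * (tp (m * σ) * Wf w b (y m)) ≤
      ∫⁻ t in T m, (∫⁻ s in Ioo a t, f s ^ r * v s) ^ (q / r) * u t := by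
    intro m hmJ
    obtain ⟨hy, hle, hge⟩ := hP m hmJ
    obtain ⟨hW0, hWt⟩ := hW _ (hyI m hmJ)
    set Φ : ℝ → ℝ≥0∞ := fun t => (∫⁻ s in Ioo (y m) t, h m s ^ r * v s) ^ (q / r) * u t with hΦ
    have hΦm : Measurable Φ := inner_meas (y m) (q / r) _ hu
    have h2 : ((2 : ℝ≥0∞)) * tp (m - 1) = tp m := by
      rw [← tp_one, ← tp_add]; congr 1; ring
    -- the part on `T m`
    have hD : tp (m - 1) * Wf w b (y m) ≤ ∫⁻ t in T m, Φ t := by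
      rcases (J.filter (· < m)).eq_empty_or_nonempty with he | hne
      · have : T m = Ioo (y m) (z m) := by simp only [hT, he]; simp
        rw [this]
        refine le_trans ?_ hge
        gcongr
        exact tp_mono (by linarith)
      · obtain ⟨k, hk, hkmax⟩ := Finset.exists_max_image _ z hne
        obtain ⟨hkJ, hkm⟩ := Finset.mem_filter.1 hk
        have hsub : Ioo (y m) (z m) ⊆ T m ∪ Ioo (y m) (z k) := by
          intro t ht
          rcases lt_or_ge t (z k) with h1 | h1
          · exact Or.inr ⟨ht.1, h1⟩
          · refine Or.inl ⟨ht, ?_⟩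
            simp only [mem_iInter, mem_Ici]
            intro m' hm'
            exact (hkmax m' hm').trans h1
        have hk2 : ∫⁻ t in Ioo (y m) (z k), Φ t ≤ tp (m - 1) * Wf w b (y m) := by
          rcases lt_or_ge (y m) (z k) with h1 | h1
          · have hb1 : ∫⁻ t in Ioo (y m) (z k), Φ t ≤ bet q r u v (y m) (z k) :=
              le_iSup (fun h : {h : ℝ → ℝ≥0∞ // Measurable h ∧ ∫⁻ t, h t ≤ 1} =>
                ∫⁻ t in Ioo (y m) (z k),
                  (∫⁻ s in Ioo (y m) t, h.1 s ^ r * v s) ^ (q / r) * u t) ⟨h m, hm m, hle⟩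
            have hb2 : (Wf w b (y m))⁻¹ * bet q r u v (y m) (z k) ≤ alp q r a b u v w (z k) :=
              le_iSup₂ (f := fun y (_ : y ∈ Ioo a (z k)) => (Wf w b y)⁻¹ * bet q r u v y (z k))
                (y m) ⟨hy.1, h1⟩
            have hb3 : (Wf w b (y m))⁻¹ * bet q r u v (y m) (z k) ≤ tp (m - 1) := by
              refine hb2.trans ((hz k hkJ).2.2.trans (tp_mono ?_))
              have := hsep m hmJ k hkJ hkm
              have h4 : ((k + 2 : ℤ) : ℝ) ≤ (m : ℝ) := by exact_mod_cast this
              push_cast at h4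
              linarith
            refine hb1.trans ?_
            calc bet q r u v (y m) (z k)
                = ((Wf w b (y m))⁻¹ * bet q r u v (y m) (z k)) * Wf w b (y m) := by
                  rw [mul_right_comm, ENNReal.inv_mul_cancel hW0.ne' hWt.ne, one_mul]
              _ ≤ _ := by gcongr
          · rw [Ioo_eq_empty (not_lt.2 h1)]; simp
        have h3 : 2 * (tp (m - 1) * Wf w b (y m)) ≤
            (∫⁻ t in T m, Φ t) + tp (m - 1) * Wf w b (y m) := by
          rw [← mul_assoc, h2]
          refine hge.trans ((lintegral_mono_set hsub).trans ((lintegral_union_le _ _ _).trans ?_))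
          gcongr
        rw [two_mul] at h3
        exact (ENNReal.add_le_add_iff_right
          (ENNReal.mul_lt_top (tp_lt_top _) hWt).ne).1 h3
    calc tp (-1) * (tp (m * σ) * Wf w b (y m))
        = c m ^ q * (tp (m - 1) * Wf w b (y m)) := by
          rw [hc, tp_rpow, ← mul_assoc, ← mul_assoc, ← tp_add, ← tp_add]
          congr 2
          rw [hσ]; field_simp; ring
      _ ≤ c m ^ q * ∫⁻ t in T m, Φ t := by gcongr
      _ = ∫⁻ t in T m, c m ^ q * Φ t := (lintegral_const_mul _ hΦm).symm
      _ ≤ _ := by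
          refine setLIntegral_mono' (hTm m) fun t ht => ?_
          rw [hΦ]
          dsimp only
          rw [← mul_assoc]
          refine mul_le_mul' ?_ le_rfl
          have e : c m ^ q = (c m ^ r) ^ (q / r) := by
            rw [← ENNReal.rpow_mul]; congr 1; field_simp
          rw [e, ← ENNReal.mul_rpow_of_nonneg _ _ hqr.le]
          refine ENNReal.rpow_le_rpow ?_ hqr.le
          calc _ = ∫⁻ s in Ioo (y m) t, c m ^ r * (h m s ^ r * v s) :=
                (lintegral_const_mul _ (((hm m).pow_const _).mul hv)).symm
            _ ≤ ∫⁻ s in Ioo (y m) t, f s ^ r * v s := by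
                refine setLIntegral_mono' measurableSet_Ioo fun s hs => ?_
                rw [← mul_assoc, ← ENNReal.mul_rpow_of_nonneg _ _ hr.le]
                refine mul_le_mul' (ENNReal.rpow_le_rpow ?_ hr.le) le_rfl
                have : h m s = g m s := (indicator_of_mem (show s ∈ Ioi (y m) from hs.1) _).symm
                rw [this]
                exact Finset.single_le_sum (f := fun m => c m * g m s) (fun _ _ => bot_le) hmJ
            _ ≤ _ := lintegral_mono_set (Ioo_subset_Ioo hy.1.le le_rfl)
  have hfin : tp (-1) * E ≤ S * E ^ (q / p) := by
    rw [hE, Finset.mul_sum]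
    exact (Finset.sum_le_sum hterm).trans (hlow.trans hL)
  have hfin2 : E ≤ (tp 1 * S) * E ^ (q / p) := by
    calc E = tp 1 * (tp (-1) * E) := by rw [← mul_assoc, tp_mul_neg, one_mul]
      _ ≤ tp 1 * (S * E ^ (q / p)) := by gcongr
      _ = _ := by rw [mul_assoc]
  have hfin3 := self_improve (by positivity) ((div_lt_one hp).2 hqp) hEt hfin2
  have e : 1 / (1 - q / p) = σ := by rw [hσ]; field_simp
  rw [e] at hfin3
  refine le_trans (Finset.sum_le_sum fun m hmJ => ?_) hfin3
  gcongr
  exact Wf_anti w b (hP m hmJ).1.2.le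

lemma bet_mono (q r : ℝ) (u v : ℝ → ℝ≥0∞) (y : ℝ) {x x' : ℝ} (hx : x ≤ x') :
    bet q r u v y x ≤ bet q r u v y x' :=
  iSup_mono fun _ => lintegral_mono_set (Ioo_subset_Ioo le_rfl hx)

lemma alp_mono (q r a : ℝ) (b : EReal) (u v w : ℝ → ℝ≥0∞) : Monotone (alp q r a b u v w) := by
  intro x x' hx
  unfold alp
  refine iSup₂_le fun y hy => ?_
  refine le_trans (mul_le_mul' le_rfl (bet_mono q r u v y hx)) ?_
  exact le_iSup₂ (f := fun y (_ : y ∈ Ioo a x') => (Wf w b y)⁻¹ * bet q r u v y x') y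
    ⟨hy.1, hy.2.trans_le hx⟩

lemma C5_lower (p q r : ℝ) (hq : 0 < q) (hqp : q < p) (hpr : p ≤ r) (hr1 : r ≤ 1) :
    ∃ C : ℝ≥0∞, C < ∞ ∧ ∀ (a : ℝ) (b : EReal) (u v w : ℝ → ℝ≥0∞), Measurable u → Measurable v →
      Measurable w →
      (∀ᵐ t ∂(volume.restrict (erIoo (a : EReal) b)), 0 < u t ∧ u t < ∞) →
      (∀ᵐ t ∂(volume.restrict (erIoo (a : EReal) b)), 0 < v t ∧ v t < ∞) →
      (∀ x : ℝ, x ∈ erIoo (a : EReal) b → 0 < Wf w b x ∧ Wf w b x < ∞) →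
      ∀ S : ℝ≥0∞, S < ∞ →
      (∀ f, Measurable f → ∀ E : ℝ≥0∞, E < ∞ → Rf p a b w f ≤ E →
        Lf q r a b u v f ≤ S * E ^ (q / p)) →
      ∫⁻ x in erIoo (a : EReal) b, w x * G5 p q r a b u v w x ≤ C * S ^ (p / (p - q)) := by
  have hp : 0 < p := by linarith
  have hr : 0 < r := by linarith
  have hpq : 0 < p - q := by linarith
  have h1q : 0 < 1 - q := by linarith
  obtain ⟨C, hC, HB⟩ := Bf_le_bet q r hq (by linarith) hr hr1
  set σ := p / (p - q) with hσ
  set e := p * (1 - q) / (p - q) with he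
  have hσ0 : 0 < σ := by positivity
  have he0 : 0 < e := by positivity
  refine ⟨C ^ e * (tp σ * (2 * tp 1 ^ σ)), ?_, ?_⟩
  · refine ENNReal.mul_lt_top (ENNReal.rpow_lt_top_of_nonneg he0.le hC.ne)
      (ENNReal.mul_lt_top (tp_lt_top _) (ENNReal.mul_lt_top (by norm_num) ?_))
    exact ENNReal.rpow_lt_top_of_nonneg hσ0.le (tp_ne_top _)
  intro a b u v w hu hv hw hup hvp hW S hS H
  have hU := U_fin hp hq hr hr1 hu hv hvp hW hS H
  have hmem : ∀ {x y : ℝ}, x ∈ erIoo (a : EReal) b → y ∈ Ioo a x → y ∈ erIoo (a : EReal) b :=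
    fun {x y} hx hy => ⟨by exact_mod_cast hy.1, lt_trans (by exact_mod_cast hy.2) hx.2⟩
  have hqp1 : 0 ≤ 1 - q / p := by
    have := (div_lt_one hp).2 hqp
    linarith
  have hfin : ∀ x ∈ erIoo (a : EReal) b, alp q r a b u v w x < ∞ := by
    intro x hx
    have hle : alp q r a b u v w x ≤ S * (Wf w b x ^ (1 - q / p))⁻¹ := by
      unfold alp
      refine iSup₂_le fun y hy => ?_
      have hyI := hmem hx hy
      obtain ⟨hW0, hWt⟩ := hW y hyI
      calc (Wf w b y)⁻¹ * bet q r u v y x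
          ≤ (Wf w b y)⁻¹ * (S * Wf w b y ^ (q / p)) := by
            gcongr
            exact bet_test hp hq hr hW H hyI hx.2.le
        _ = S * (Wf w b y ^ (1 - q / p))⁻¹ := by
            rw [mul_left_comm, ← ENNReal.rpow_neg_one, ← ENNReal.rpow_add _ _ hW0.ne' hWt.ne,
              ← ENNReal.rpow_neg]
            congr 2; ring
        _ ≤ _ := by
            refine mul_le_mul' le_rfl (ENNReal.inv_le_inv.2 (ENNReal.rpow_le_rpow ?_ hqp1))
            exact Wf_anti w b hy.2.le
    refine hle.trans_lt (ENNReal.mul_lt_top hS (ENNReal.inv_lt_top.2 ?_))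
    exact ENNReal.rpow_pos (hW x hx).1 (hW x hx).2.ne
  have hG : ∀ x ∈ erIoo (a : EReal) b, G5 p q r a b u v w x ≤ C ^ e * alp q r a b u v w x ^ σ := by
    intro x hx
    unfold G5
    refine essSup_le_of_ae_le _ ?_
    rw [Filter.EventuallyLE, ae_restrict_iff' measurableSet_Ioo]
    refine Filter.Eventually.of_forall fun y hy => ?_
    have hyI := hmem hx hy
    obtain ⟨hW0, hWt⟩ := hW y hyI
    have hsub : Ioo y x ⊆ erIoo (a : EReal) b := Ioo_subset_erIoo hyI.1.le hx.2.le
    have hbt : bet q r u v y x < ∞ := (bet_test hp hq hr hW H hyI hx.2.le).trans_lt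
      (ENNReal.mul_lt_top hS (ENNReal.rpow_lt_top_of_nonneg (by positivity) hWt.ne))
    have hB := HB u v hu hv y x
      (ae_restrict_of_ae_restrict_of_subset hsub (hup.mono fun t ht => ht.1))
      (ae_restrict_of_ae_restrict_of_subset hsub (hvp.mono fun t ht => ht.2))
      (fun t ht => lt_of_le_of_lt (lintegral_mono_set (Ioo_subset_erIoo le_rfl hx.2.le))
        (hU t (hsub ht))) hbt
    calc Wf w b y ^ (-σ) * Bf q r u v y x ^ e
        ≤ Wf w b y ^ (-σ) * (C * bet q r u v y x ^ (1 / (1 - q))) ^ e := by gcongr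
      _ = C ^ e * ((Wf w b y)⁻¹ * bet q r u v y x) ^ σ := by
          rw [ENNReal.mul_rpow_of_nonneg _ _ he0.le, ENNReal.mul_rpow_of_nonneg _ _ hσ0.le,
            ← ENNReal.rpow_mul, mul_left_comm, ENNReal.rpow_neg, ENNReal.inv_rpow]
          congr 3
          rw [he, hσ]; field_simp
      _ ≤ _ := by
          refine mul_le_mul' le_rfl (ENNReal.rpow_le_rpow ?_ hσ0.le)
          exact le_iSup₂ (f := fun y (_ : y ∈ Ioo a x) => (Wf w b y)⁻¹ * bet q r u v y x) y hy
  have hmon : Monotone fun x => alp q r a b u v w x := alp_mono q r a b u v w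
  calc ∫⁻ x in erIoo (a : EReal) b, w x * G5 p q r a b u v w x
      ≤ ∫⁻ x in erIoo (a : EReal) b, C ^ e * (w x * alp q r a b u v w x ^ σ) := by
        refine setLIntegral_mono' (measurableSet_erIoo _ _) fun x hx => ?_
        rw [mul_left_comm]
        exact mul_le_mul' le_rfl (hG x hx)
    _ = C ^ e * ∫⁻ x in erIoo (a : EReal) b, w x * alp q r a b u v w x ^ σ :=
        lintegral_const_mul _ (hw.mul (hmon.measurable.pow_const _))
    _ ≤ C ^ e * (tp σ * (2 * (tp 1 * S) ^ σ)) := by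
        refine mul_le_mul' le_rfl ?_
        refine layers (Ψ := Wf w b) (hmon.monotoneOn _) hfin hσ0 hw (fun z _ => le_rfl) ?_
        intro J z hz
        rw [← Finset.sum_filter_add_sum_filter_not J (fun m : ℤ => Even m), two_mul]
        refine add_le_add ?_ ?_
        · refine sep_bound hq hqp hr (by linarith) hu hv hw hW H _ z ?_ ?_
          · intro m hm m' hm' hlt
            obtain ⟨i, hi⟩ := (Finset.mem_filter.1 hm).2
            obtain ⟨j, hj⟩ := (Finset.mem_filter.1 hm').2
            omega
          · exact fun m hm => hz m (Finset.mem_filter.1 hm).1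
        · refine sep_bound hq hqp hr (by linarith) hu hv hw hW H _ z ?_ ?_
          · intro m hm m' hm' hlt
            have h1 := (Finset.mem_filter.1 hm).2
            have h2 := (Finset.mem_filter.1 hm').2
            rw [Int.not_even_iff] at h1 h2
            omega
          · exact fun m hm => hz m (Finset.mem_filter.1 hm).1
    _ = _ := by
        rw [ENNReal.mul_rpow_of_nonneg _ _ hσ0.le]
        ring

/-- If the right-hand side vanishes, so does the left-hand side. -/
lemma Lf_zero {p q r a : ℝ} {b : EReal} {u v w f : ℝ → ℝ≥0∞} (hp : 0 < p) (hq : 0 < q)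
    (hr : 0 < r) (hf : Measurable f) (hw : Measurable w)
    (hwp : ∀ᵐ t ∂(volume.restrict (erIoo (a : EReal) b)), 0 < w t)
    (h : Rf p a b w f = 0) : Lf q r a b u v f = 0 := by
  have hqr : 0 < q / r := by positivity
  unfold Rf at h
  rw [lintegral_eq_zero_iff (inner_meas a p _ hw)] at h
  unfold Lf
  rw [lintegral_congr_ae (g := fun _ => 0)]
  · simp
  filter_upwards [h, hwp] with t ht hwt
  simp only [Pi.zero_apply, mul_eq_zero, ENNReal.rpow_eq_zero_iff_of_pos hp, hwt.ne',
    or_false] at ht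
  rw [lintegral_eq_zero_iff hf] at ht
  have : ∫⁻ s in Ioo a t, f s ^ r * v s = 0 := by
    rw [lintegral_congr_ae (g := fun _ => 0)]
    · simp
    filter_upwards [ht] with s hs
    simp only [Pi.zero_apply] at hs
    simp [hs, ENNReal.zero_rpow_of_pos hr]
  rw [this, ENNReal.zero_rpow_of_pos hqr, zero_mul]

lemma lower_final (p q r : ℝ) (hq : 0 < q) (hqp : q < p) (hpr : p ≤ r) (hr1 : r ≤ 1) :
    ∃ K : ℝ≥0∞, 0 < K ∧ K < ∞ ∧ ∀ (a : ℝ) (b : EReal) (u v w : ℝ → ℝ≥0∞), Measurable u →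
      Measurable v → Measurable w →
      (∀ᵐ t ∂(volume.restrict (erIoo (a : EReal) b)), 0 < u t ∧ u t < ∞) →
      (∀ᵐ t ∂(volume.restrict (erIoo (a : EReal) b)), 0 < v t ∧ v t < ∞) →
      (∀ᵐ t ∂(volume.restrict (erIoo (a : EReal) b)), 0 < w t ∧ w t < ∞) →
      (∀ x : ℝ, x ∈ erIoo (a : EReal) b → 0 < Wf w b x ∧ Wf w b x < ∞) →
      C4const p q r a b u v w + C5const p q r a b u v w ≤ K *
        (⨆ f ∈ {f : ℝ → ℝ≥0∞ | Measurable f}, mainLHS q r a b u v f / mainRHS p a b w f) := by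
  have hp : 0 < p := by linarith
  have hr : 0 < r := by linarith
  have hpq : 0 < p - q := by linarith
  obtain ⟨C, hC, H4⟩ := C4_lower p q r hq hqp hpr hr1
  obtain ⟨D, hD, H5⟩ := C5_lower p q r hq hqp hpr hr1
  set τ := (p - q) / (p * q) with hτ
  have hτ0 : 0 < τ := by positivity
  refine ⟨C ^ τ + D ^ τ + 1, by positivity, ?_, ?_⟩
  · exact ENNReal.add_lt_top.2 ⟨ENNReal.add_lt_top.2
      ⟨ENNReal.rpow_lt_top_of_nonneg hτ0.le hC.ne, ENNReal.rpow_lt_top_of_nonneg hτ0.le hD.ne⟩,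
      by norm_num⟩
  intro a b u v w hu hv hw hup hvp hwp hW
  set 𝒮 := ⨆ f ∈ {f : ℝ → ℝ≥0∞ | Measurable f}, mainLHS q r a b u v f / mainRHS p a b w f with h𝒮
  rcases eq_or_ne 𝒮 ∞ with ht | ht
  · rw [ht, ENNReal.mul_top]
    · exact le_top
    · simp
  have H : ∀ f, Measurable f → ∀ E : ℝ≥0∞, E < ∞ → Rf p a b w f ≤ E →
      Lf q r a b u v f ≤ 𝒮 ^ q * E ^ (q / p) := by
    intro f hf E hE hfE
    rcases eq_or_ne (Rf p a b w f) 0 with h0 | h0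
    · rw [Lf_zero hp hq hr hf hw (hwp.mono fun t h => h.1) h0]
      exact bot_le
    · have hR0 : mainRHS p a b w f ≠ 0 := by
        change Rf p a b w f ^ (1 / p) ≠ 0
        intro h
        exact h0 ((ENNReal.rpow_eq_zero_iff_of_pos (by positivity)).1 h)
      have hRt : mainRHS p a b w f ≠ ∞ :=
        ENNReal.rpow_ne_top_of_nonneg (by positivity) (hfE.trans_lt hE).ne
      have h1 : mainLHS q r a b u v f / mainRHS p a b w f ≤ 𝒮 :=
        le_iSup₂ (f := fun f (_ : f ∈ {f : ℝ → ℝ≥0∞ | Measurable f}) =>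
          mainLHS q r a b u v f / mainRHS p a b w f) f hf
      have h2 : mainLHS q r a b u v f ≤ 𝒮 * mainRHS p a b w f :=
        (ENNReal.div_le_iff hR0 hRt).1 h1
      have h3 := ENNReal.rpow_le_rpow h2 hq.le
      have e1 : mainLHS q r a b u v f ^ q = Lf q r a b u v f := by
        change (Lf q r a b u v f ^ (1 / q)) ^ q = _
        rw [← ENNReal.rpow_mul, one_div, inv_mul_cancel₀ hq.ne', ENNReal.rpow_one]
      have e2 : mainRHS p a b w f ^ q = Rf p a b w f ^ (q / p) := by
        change (Rf p a b w f ^ (1 / p)) ^ q = _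
        rw [← ENNReal.rpow_mul]; congr 1; ring
      rw [e1, ENNReal.mul_rpow_of_nonneg _ _ hq.le, e2] at h3
      refine h3.trans ?_
      gcongr
  have hSq : 𝒮 ^ q < ∞ := ENNReal.rpow_lt_top_of_nonneg hq.le ht
  have key : ∀ (X K : ℝ≥0∞), X ≤ K * (𝒮 ^ q) ^ (p / (p - q)) → X ^ τ ≤ K ^ τ * 𝒮 := by
    intro X K h
    have h1 := ENNReal.rpow_le_rpow h hτ0.le
    rw [ENNReal.mul_rpow_of_nonneg _ _ hτ0.le, ← ENNReal.rpow_mul, ← ENNReal.rpow_mul] at h1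
    have e : q * (p / (p - q)) * τ = 1 := by rw [hτ]; field_simp
    rw [show q * ((p / (p - q)) * τ) = 1 by rw [← mul_assoc]; exact e, ENNReal.rpow_one] at h1
    exact h1
  have k4 := key _ _ (H4 a b u v w hu hv hw hup hvp hW _ hSq H)
  have k5 := key _ _ (H5 a b u v w hu hv hw hup hvp hW _ hSq H)
  rw [C4_eq, C5_eq]
  refine (add_le_add k4 k5).trans ?_
  rw [← add_mul]
  exact mul_le_mul' le_self_add le_rfl

/-- Case (v) of the main theorem: for `q < p ≤ r ≤ 1` the weighted iterated Hardy-type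
inequality holds for all nonnegative measurable `f` iff `C₄ < ∞` and `C₅ < ∞`, and the best
constant is equivalent to `C₄ + C₅`, with equivalence constants depending only on `p, q, r`. -/
theorem main_theorem_case_v (p q r : ℝ) (hq : 0 < q) (hqp : q < p) (hpr : p ≤ r) (hr1 : r ≤ 1) :
    ∃ κ₁ κ₂ : ℝ≥0∞, 0 < κ₁ ∧ κ₂ < ∞ ∧
      ∀ (a : ℝ) (b : EReal), 0 ≤ a → (a : EReal) < b →
        ∀ (u v w : ℝ → ℝ≥0∞), Measurable u → Measurable v → Measurable w →
          (∀ᵐ t ∂(volume.restrict (erIoo (a : EReal) b)), 0 < u t ∧ u t < ∞) →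
          (∀ᵐ t ∂(volume.restrict (erIoo (a : EReal) b)), 0 < v t ∧ v t < ∞) →
          (∀ᵐ t ∂(volume.restrict (erIoo (a : EReal) b)), 0 < w t ∧ w t < ∞) →
          (∀ x : ℝ, x ∈ erIoo (a : EReal) b → 0 < Wf w b x ∧ Wf w b x < ∞) →
          ((∃ C : ℝ≥0∞, C < ∞ ∧ ∀ f : ℝ → ℝ≥0∞, Measurable f →
                mainLHS q r a b u v f ≤ C * mainRHS p a b w f) ↔
              (C4const p q r a b u v w < ∞ ∧ C5const p q r a b u v w < ∞)) ∧
            κ₁ * (C4const p q r a b u v w + C5const p q r a b u v w) ≤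
              (⨆ f ∈ {f : ℝ → ℝ≥0∞ | Measurable f},
                mainLHS q r a b u v f / mainRHS p a b w f) ∧
            (⨆ f ∈ {f : ℝ → ℝ≥0∞ | Measurable f},
                mainLHS q r a b u v f / mainRHS p a b w f) ≤
              κ₂ * (C4const p q r a b u v w + C5const p q r a b u v w) := by
  obtain ⟨K₂, hK₂, hup⟩ := upper_final p q r hq hqp hpr hr1
  obtain ⟨K₁, hK₁, hK₁t, hlow⟩ := lower_final p q r hq hqp hpr hr1
  refine ⟨K₁⁻¹, K₂, ENNReal.inv_pos.2 hK₁t.ne, hK₂, ?_⟩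
  intro a b _ hab u v w hu hv hw hu0 hv0 hw0 hW
  have hU := hup a b u v w hab hu hv hw (hu0.mono fun t h => h.1) (hv0.mono fun t h => h.1)
    (hw0.mono fun t h => h.1) hW
  have hL := hlow a b u v w hu hv hw hu0 hv0 hw0 hW
  refine ⟨⟨?_, ?_⟩, ?_, ?_⟩
  · rintro ⟨C, hC, hCf⟩
    have h1 : (⨆ f ∈ {f : ℝ → ℝ≥0∞ | Measurable f},
        mainLHS q r a b u v f / mainRHS p a b w f) ≤ C :=
      iSup₂_le fun f hf => ENNReal.div_le_of_le_mul (hCf f hf)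
    have h2 := (hL.trans (mul_le_mul' le_rfl h1)).trans_lt (ENNReal.mul_lt_top hK₁t hC)
    exact ENNReal.add_lt_top.1 h2
  · rintro ⟨h4, h5⟩
    exact ⟨K₂ * (C4const p q r a b u v w + C5const p q r a b u v w),
      ENNReal.mul_lt_top hK₂ (ENNReal.add_lt_top.2 ⟨h4, h5⟩), hU⟩
  · refine (mul_le_mul' le_rfl hL).trans (le_of_eq ?_)
    rw [← mul_assoc, ENNReal.inv_mul_cancel hK₁.ne' hK₁t.ne, one_mul]
  · exact iSup₂_le fun f hf => ENNReal.div_le_of_le_mul (hU f hf)
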